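/- arXiv:1506.00864 — 7 statements merged into one kernel-verified Lean document; each statement's English description precedes it below -/
import Mathlib

section
/- Let n be odd, let 1 ≤ k ≤ n/2, and let F be an intersecting k-Sperner family of subsets of [n] with |F| = Σ_I(n,k). Then F = H_{0,n,k}, i.e., F = {S ⊆ [n] : ⌊n/2⌋+1 ≤ |S| ≤ ⌊n/2⌋+k}. -/
/-- `Σ_I(n,k)` from the paper. -/
def SigmaI (n k : ℕ) : ℕ :=
  if n % 2 = 1 then
    ∑ i ∈ Finset.Icc ((n + 1) / 2) ((n + 1) / 2 + k - 1), Nat.choose n i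
  else
    Nat.choose (n - 1) (n / 2 - 1) +
      ∑ i ∈ Finset.Icc (n / 2 + 1) (n / 2 + k - 1), Nat.choose n i +
      Nat.choose (n - 1) (n / 2 + k)

/-- A family of finite sets is intersecting if any two members meet. -/
def Intersecting {α : Type*} [DecidableEq α] (F : Finset (Finset α)) : Prop :=
  ∀ A ∈ F, ∀ B ∈ F, (A ∩ B).Nonempty

/-- A family is butterfly-free if there are no four distinct members
`A,B,C,D` with `A ⊆ C`, `A ⊆ D`, `B ⊆ C`, `B ⊆ D`. -/
def ButterflyFree {α : Type*} (F : Finset (Finset α)) : Prop :=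
  ¬ ∃ A B C D : Finset α, A ∈ F ∧ B ∈ F ∧ C ∈ F ∧ D ∈ F ∧
    A ≠ B ∧ A ≠ C ∧ A ≠ D ∧ B ≠ C ∧ B ≠ D ∧ C ≠ D ∧
    A ⊆ C ∧ A ⊆ D ∧ B ⊆ C ∧ B ⊆ D

/-- A family is `k`-Sperner if it contains no chain of `k+1` distinct sets. -/
def KSperner {α : Type*} (k : ℕ) (F : Finset (Finset α)) : Prop :=
  ¬ ∃ c : Fin (k + 1) → Finset α, (∀ i, c i ∈ F) ∧ StrictMono c

open Finset in
theorem KSperner.card_le_of_chain {α : Type*} {k : ℕ} {F : Finset (Finset α)}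
    (hS : KSperner k F) {G : Finset (Finset α)} (hGF : G ⊆ F)
    (hG : ∀ A ∈ G, ∀ B ∈ G, A ⊆ B ∨ B ⊆ A) : #G ≤ k := by
  by_contra! hlt
  have hinj : Set.InjOn Finset.card (G : Set (Finset α)) := by
    intro A hA B hB hAB
    rcases hG A hA B hB with h | h
    · exact eq_of_subset_of_card_le h hAB.ge
    · exact (eq_of_subset_of_card_le h hAB.le).symm
  have hT : k + 1 ≤ #(G.image Finset.card) := by
    rw [card_image_of_injOn hinj]
    exact hlt
  have hmem : ∀ i, ∃ A ∈ G, #A = orderEmbOfCardLe _ hT i := fun i ↦ by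
    simpa using orderEmbOfCardLe_mem _ hT i
  choose c hcG hc using hmem
  refine hS ⟨c, fun i ↦ hGF (hcG i), fun i j hij ↦ ?_⟩
  have hlt' : #(c i) < #(c j) := by
    rw [hc, hc]
    exact (orderEmbOfCardLe _ hT).strictMono hij
  rcases hG _ (hcG i) _ (hcG j) with h | h
  · exact ⟨h, fun h' ↦ by have := card_le_card h'; omega⟩
  · have := card_le_card h
    omega

/-- The distance of a set size `s` from the two middle levels `m`, `m + 1` of a
`(2 * m + 1)`-element ground set. -/
def middleDist (m s : ℕ) : ℕ := if m < s then s - (m + 1) else m - s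

theorem choose_middleDist {m s : ℕ} (hs : s ≤ 2 * m + 1) :
    (2 * m + 1).choose (m + 1 + middleDist m s) = (2 * m + 1).choose s := by
  unfold middleDist
  split_ifs with h
  · congr 1
    omega
  · rw [← Nat.choose_symm hs]
    congr 1
    omega

theorem choose_upper_half_lt {m i j : ℕ} (hij : i < j) (hj : j < m + 1) :
    (2 * m + 1).choose (m + 1 + j) < (2 * m + 1).choose (m + 1 + i) := by
  have step : ∀ i < m, (2 * m + 1).choose (m + 1 + i + 1) < (2 * m + 1).choose (m + 1 + i) := by
    intro i hi
    have h := Nat.choose_succ_right_eq (2 * m + 1) (m + 1 + i)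
    have hpos : 0 < (2 * m + 1).choose (m + 1 + i) := Nat.choose_pos (by omega)
    have hsub : 2 * m + 1 - (m + 1 + i) < m + 1 + i + 1 := by omega
    by_contra! hle
    exact ((Nat.mul_lt_mul_of_pos_left hsub hpos).trans_le (Nat.mul_le_mul_right _ hle)).ne h.symm
  induction j, hij using Nat.le_induction with
  | base => exact step i (by omega)
  | succ j hij ih => exact (step j (by omega)).trans (ih (by omega))

open Finset in
/-- A sum of at most `2 * k` terms of a positive, strictly decreasing sequence, each used at most
twice, is at most twice the sum of the first `k` terms; the second part is the equality case. -/
theorem sum_mul_le_two_mul_sum {M k : ℕ} (hk : 1 ≤ k) (hkM : k ≤ M) {f x : ℕ → ℕ}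
    (hpos : ∀ i < M, 0 < f i) (hf : ∀ i j, i < j → j < M → f j < f i)
    (hx : ∀ d, x d ≤ 2) (hsum : ∑ d ∈ range M, x d ≤ 2 * k) :
    ∑ d ∈ range M, x d * f d ≤ 2 * ∑ d ∈ range k, f d ∧
    (∑ d ∈ range M, x d * f d = 2 * ∑ d ∈ range k, f d →
      ∑ d ∈ range M, x d = 2 * k ∧ ∀ d < M, k ≤ d → x d = 0) := by
  obtain ⟨c, hc⟩ : ∃ c : ℤ, c = f (k - 1) := ⟨_, rfl⟩
  have hcpos : 0 < c := by
    rw [hc]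
    exact_mod_cast hpos (k - 1) (by omega)
  have hlhs : (∑ d ∈ range M, x d * f d : ℤ) =
      ∑ d ∈ range M, (x d : ℤ) * (f d - c) + c * ∑ d ∈ range M, (x d : ℤ) := by
    rw [mul_sum, ← sum_add_distrib]
    exact sum_congr rfl fun d _ ↦ by ring
  have hrhs : (2 * ∑ d ∈ range k, (f d : ℤ)) =
      ∑ d ∈ range M, (if d < k then 2 * ((f d : ℤ) - c) else 0) + c * (2 * k) := by
    rw [← sum_filter, show (range M).filter (· < k) = range k by ext; simp; omega,
      ← mul_sum, sum_sub_distrib]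
    simp
    ring
  have hterm : ∀ d ∈ range M,
      (x d : ℤ) * (f d - c) ≤ if d < k then 2 * ((f d : ℤ) - c) else 0 := by
    intro d hd
    have hd := mem_range.1 hd
    split_ifs with h
    · have h0 : (0 : ℤ) ≤ f d - c := by
        rcases (show d = k - 1 ∨ d < k - 1 by omega) with rfl | h'
        · simp [hc]
        · have := hf d (k - 1) h' (by omega)
          omega
      exact mul_le_mul_of_nonneg_right (by exact_mod_cast hx d) h0
    · have := hf (k - 1) d (by omega) hd
      exact mul_nonpos_of_nonneg_of_nonpos (by positivity) (by omega)
  have hle := sum_le_sum hterm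
  have hsum' : (∑ d ∈ range M, (x d : ℤ)) ≤ 2 * k := by exact_mod_cast hsum
  have hmul := mul_le_mul_of_nonneg_left hsum' hcpos.le
  constructor
  · zify
    linarith
  · intro heq
    zify at heq
    have h1 : c * ∑ d ∈ range M, (x d : ℤ) = c * (2 * k) := by linarith
    have h2 := (sum_eq_sum_iff_of_le hterm).1 (by linarith)
    refine ⟨by exact_mod_cast mul_left_cancel₀ hcpos.ne' h1, fun d hd hkd ↦ ?_⟩
    have h3 := h2 d (mem_range.2 hd)
    rw [if_neg (by omega)] at h3
    have := hf (k - 1) d (by omega) hd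
    rcases mul_eq_zero.1 h3 with h | h
    · exact_mod_cast h
    · omega

section Numbering

open Finset Numbering

variable {α : Type*} [Fintype α]

theorem Numbering.IsPrefix.subset_or_subset {f : Numbering α} {A B : Finset α}
    (hA : f.IsPrefix A) (hB : f.IsPrefix B) : A ⊆ B ∨ B ⊆ A :=
  (le_total #A #B).imp (hA.subset_of_card_le_card hB) (hB.subset_of_card_le_card hA)

theorem sum_card_middleDist_fiber {m : ℕ} (hα : Fintype.card α = 2 * m + 1)
    (G : Finset (Finset α)) :
    ∑ d ∈ range (m + 1), #{A ∈ G | middleDist m #A = d} = #G := by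
  refine (card_eq_sum_card_fiberwise fun A _ ↦ ?_).symm
  have := card_le_univ A
  simp only [coe_range, Set.mem_Iio, middleDist]
  split_ifs <;> omega

theorem sum_choose_card_eq {m : ℕ} (hα : Fintype.card α = 2 * m + 1)
    (G : Finset (Finset α)) :
    ∑ A ∈ G, (Fintype.card α).choose #A = ∑ d ∈ range (m + 1),
      #{A ∈ G | middleDist m #A = d} * (2 * m + 1).choose (m + 1 + d) := by
  rw [← sum_fiberwise_of_maps_to (g := fun A ↦ middleDist m #A) (t := range (m + 1))]
  · refine sum_congr rfl fun d _ ↦ ?_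
    rw [← smul_eq_mul, ← sum_const]
    refine sum_congr rfl fun A hA ↦ ?_
    rw [← (mem_filter.1 hA).2, choose_middleDist (hα ▸ card_le_univ A), hα]
  · intro A _
    have := card_le_univ A
    simp only [mem_range, middleDist]
    split_ifs <;> omega

variable [DecidableEq α]

/-- The members of `F` that are initial segments of the numbering `f`. -/
def prefixMembers (F : Finset (Finset α)) (f : Numbering α) : Finset (Finset α) :=
  F.filter fun A ↦ f.IsPrefix A

/-- The members of `F` that are final segments of the numbering `f`. -/
def suffixMembers (F : Finset (Finset α)) (f : Numbering α) : Finset (Finset α) :=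
  F.filter fun A ↦ f.IsPrefix Aᶜ

theorem card_prefixMembers_le {k : ℕ} {F : Finset (Finset α)} (hS : KSperner k F)
    (f : Numbering α) : #(prefixMembers F f) ≤ k :=
  hS.card_le_of_chain (filter_subset _ _) fun _ hA _ hB ↦
    (mem_filter.1 hA).2.subset_or_subset (mem_filter.1 hB).2

theorem suffixMembers_chain {F : Finset (Finset α)} {f : Numbering α} :
    ∀ A ∈ suffixMembers F f, ∀ B ∈ suffixMembers F f, A ⊆ B ∨ B ⊆ A := fun _ hA _ hB ↦
  ((mem_filter.1 hA).2.subset_or_subset (mem_filter.1 hB).2).symm.imp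
    compl_subset_compl.1 compl_subset_compl.1

theorem card_suffixMembers_le {k : ℕ} {F : Finset (Finset α)} (hS : KSperner k F)
    (f : Numbering α) : #(suffixMembers F f) ≤ k :=
  hS.card_le_of_chain (filter_subset _ _) suffixMembers_chain

theorem card_middleDist_fiber_le {m : ℕ} (hα : Fintype.card α = 2 * m + 1)
    {F : Finset (Finset α)} (hF : Intersecting F) (f : Numbering α) (d : ℕ) :
    #{A ∈ prefixMembers F f | middleDist m #A = d} +
      #{A ∈ suffixMembers F f | middleDist m #A = d} ≤ 2 := by
  rw [← card_image_of_injective {A ∈ suffixMembers F f | middleDist m #A = d} compl_injective,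
    ← card_union_of_disjoint]
  · refine (card_le_card_of_injOn (t := {m + 1 + d, m - d}) Finset.card ?_ ?_).trans card_le_two
    · intro A hA
      simp only [coe_union, coe_image, Set.mem_union, Set.mem_image, mem_coe, mem_filter] at hA
      simp only [coe_insert, coe_singleton, Set.mem_insert_iff, Set.mem_singleton_iff]
      rcases hA with ⟨-, h⟩ | ⟨B, ⟨-, h⟩, rfl⟩
      · unfold middleDist at h
        split_ifs at h <;> omega
      · have := card_le_univ B
        rw [card_compl]
        unfold middleDist at h
        split_ifs at h <;> omega
    · have hpre : ∀ A ∈ {A ∈ prefixMembers F f | middleDist m #A = d} ∪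
          {A ∈ suffixMembers F f | middleDist m #A = d}.image compl, f.IsPrefix A := by
        intro A hA
        simp only [mem_union, mem_image, mem_filter, prefixMembers, suffixMembers] at hA
        rcases hA with h | ⟨B, h, rfl⟩
        · exact h.1.2
        · exact h.1.2
      intro A hA B hB hAB
      exact (hpre A hA).subset_of_card_le_card (hpre B hB) hAB.le |>.antisymm <|
        (hpre B hB).subset_of_card_le_card (hpre A hA) hAB.ge
  · rw [disjoint_left]
    intro A hA hA'
    simp only [mem_image, mem_filter, prefixMembers, suffixMembers] at hA hA'
    obtain ⟨B, hB, rfl⟩ := hA'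
    simpa [inter_comm Bᶜ] using hF _ hA.1.1 _ hB.1.1

/-- The weight of the members of `F` on the chain of initial segments and on the chain of final
segments of `f`. -/
def chainWeight (F : Finset (Finset α)) (f : Numbering α) : ℕ :=
  ∑ A ∈ prefixMembers F f, (Fintype.card α).choose #A +
    ∑ A ∈ suffixMembers F f, (Fintype.card α).choose #A

theorem sum_chainWeight (F : Finset (Finset α)) :
    ∑ f : Numbering α, chainWeight F f = (Fintype.card α).factorial * (2 * #F) := by
  have h : ∀ A : Finset α, (Fintype.card α).choose #A * #(prefixed A) =
      (Fintype.card α).factorial := fun A ↦ by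
    rw [card_prefixed, ← mul_assoc, Nat.choose_mul_factorial_mul_factorial (card_le_univ A)]
  have h' : ∀ A : Finset α, (Fintype.card α).choose #A * #(prefixed Aᶜ) =
      (Fintype.card α).factorial := fun A ↦ by
    rw [← h Aᶜ, card_compl, Nat.choose_symm (card_le_univ A)]
  simp only [chainWeight, prefixMembers, suffixMembers, sum_filter, sum_add_distrib]
  rw [sum_comm, sum_comm (s := univ)]
  simp only [← sum_filter, sum_const, smul_eq_mul]
  have e : ∀ A : Finset α, (univ.filter fun f : Numbering α ↦ f.IsPrefix A) = prefixed A :=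
    fun A ↦ rfl
  simp only [e, mul_comm (#(prefixed _)), h, h', sum_const, smul_eq_mul]
  ring

theorem chainWeight_le {m k : ℕ} (hα : Fintype.card α = 2 * m + 1) (hk : 1 ≤ k) (hkm : k ≤ m)
    {F : Finset (Finset α)} (hF : Intersecting F) (hS : KSperner k F) (f : Numbering α) :
    chainWeight F f ≤ 2 * ∑ d ∈ range k, (2 * m + 1).choose (m + 1 + d) ∧
    (chainWeight F f = 2 * ∑ d ∈ range k, (2 * m + 1).choose (m + 1 + d) →
      ∀ A ∈ prefixMembers F f, m + 1 ≤ #A ∧ #A ≤ m + k) := by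
  have hP := card_prefixMembers_le hS f
  have hQ := card_suffixMembers_le hS f
  have hsum : ∑ d ∈ range (m + 1), (#{A ∈ prefixMembers F f | middleDist m #A = d} +
      #{A ∈ suffixMembers F f | middleDist m #A = d}) =
      #(prefixMembers F f) + #(suffixMembers F f) := by
    rw [sum_add_distrib, sum_card_middleDist_fiber hα, sum_card_middleDist_fiber hα]
  have hw : chainWeight F f = ∑ d ∈ range (m + 1),
      (#{A ∈ prefixMembers F f | middleDist m #A = d} +
        #{A ∈ suffixMembers F f | middleDist m #A = d}) * (2 * m + 1).choose (m + 1 + d) := by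
    simp only [chainWeight, sum_choose_card_eq hα, add_mul, sum_add_distrib]
  obtain ⟨hle, heq⟩ := sum_mul_le_two_mul_sum hk (show k ≤ m + 1 by omega)
    (fun i hi ↦ Nat.choose_pos (show m + 1 + i ≤ 2 * m + 1 by omega))
    (fun _ _ hij hj ↦ choose_upper_half_lt hij hj)
    (card_middleDist_fiber_le hα hF f) (by omega)
  rw [hw]
  refine ⟨hle, fun h A hA ↦ ?_⟩
  obtain ⟨hcard, hzero⟩ := heq h
  rw [hsum] at hcard
  have hdist : ∀ B ∈ prefixMembers F f ∪ suffixMembers F f, middleDist m #B < k := by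
    intro B hB
    by_contra! hkB
    have hBn := card_le_univ B
    have h0 := hzero (middleDist m #B) (by unfold middleDist; split_ifs <;> omega) hkB
    rw [Nat.add_eq_zero_iff, card_eq_zero, card_eq_zero, filter_eq_empty_iff,
      filter_eq_empty_iff] at h0
    rcases mem_union.1 hB with h | h
    · exact h0.1 h rfl
    · exact h0.2 h rfl
  have hdA := hdist A (mem_union_left _ hA)
  obtain hmA | hmA := lt_or_ge m #A
  · rw [middleDist, if_pos hmA] at hdA
    omega
  · exfalso
    have hbig : ∀ B ∈ suffixMembers F f, m + 2 ≤ #B := by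
      intro B hB
      by_contra! hlt
      have hsub : A ⊆ Bᶜ := (mem_filter.1 hA).2.subset_of_card_le_card (mem_filter.1 hB).2 (by
        rw [card_compl]
        omega)
      have hne := hF A (mem_filter.1 hA).1 B (mem_filter.1 hB).1
      rw [← not_disjoint_iff_nonempty_inter] at hne
      exact hne (subset_compl_iff_disjoint_right.1 hsub)
    have hQk : #(suffixMembers F f) ≤ #(Icc (m + 2) (m + k)) := by
      refine card_le_card_of_injOn Finset.card (fun B hB ↦ ?_) fun B hB C hC hBC ↦ ?_
      · have h1 := hbig B hB
        have h2 := hdist B (mem_union_right _ hB)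
        rw [middleDist, if_pos (by omega)] at h2
        simp only [coe_Icc, Set.mem_Icc]
        omega
      · rcases suffixMembers_chain B hB C hC with h | h
        · exact eq_of_subset_of_card_le h hBC.ge
        · exact (eq_of_subset_of_card_le h hBC.le).symm
    rw [Nat.card_Icc] at hQk
    omega

end Numbering

theorem SigmaI_odd {m k : ℕ} (hk : 1 ≤ k) :
    SigmaI (2 * m + 1) k = ∑ d ∈ Finset.range k, (2 * m + 1).choose (m + 1 + d) := by
  rw [SigmaI, if_pos (by omega), show (2 * m + 1 + 1) / 2 = m + 1 by omega,
    show Finset.Icc (m + 1) (m + 1 + k - 1) = Finset.Ico (m + 1) (m + 1 + k) by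
      ext; simp only [Finset.mem_Icc, Finset.mem_Ico]; omega, Finset.sum_Ico_eq_sum_range]
  simp

theorem card_filter_levels {m k : ℕ} :
    (Finset.univ.filter (fun S : Finset (Fin (2 * m + 1)) =>
      m + 1 ≤ S.card ∧ S.card ≤ m + k)).card =
      ∑ d ∈ Finset.range k, (2 * m + 1).choose (m + 1 + d) := by
  rw [Finset.card_eq_sum_card_fiberwise (f := fun S ↦ S.card - (m + 1)) (t := Finset.range k)]
  · refine Finset.sum_congr rfl fun d hd ↦ ?_
    have hd := Finset.mem_range.1 hd
    rw [← Finset.card_fin (2 * m + 1), ← Finset.card_powersetCard, Finset.card_fin]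
    congr 1
    ext S
    simp only [Finset.mem_filter, Finset.mem_univ, true_and, Finset.mem_powersetCard,
      Finset.subset_univ]
    omega
  · intro S hS
    simp only [Finset.coe_filter, Finset.mem_univ, true_and, Set.mem_ofPred_eq] at hS
    simp only [Finset.coe_range, Set.mem_Iio]
    omega

theorem intersecting_kSperner_eq_odd (n k : ℕ) (hodd : n % 2 = 1)
    (hk1 : 1 ≤ k) (hk2 : 2 * k ≤ n)
    (F : Finset (Finset (Fin n))) (hF : Intersecting F) (hS : KSperner k F)
    (hcard : F.card = SigmaI n k) :
    F = Finset.univ.filter (fun S : Finset (Fin n) =>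
      n / 2 + 1 ≤ S.card ∧ S.card ≤ n / 2 + k) := by
  obtain ⟨m, rfl⟩ : ∃ m, n = 2 * m + 1 := ⟨n / 2, by omega⟩
  rw [show (2 * m + 1) / 2 = m by omega]
  rw [SigmaI_odd hk1] at hcard
  have hα : Fintype.card (Fin (2 * m + 1)) = 2 * m + 1 := Fintype.card_fin _
  have hmain := chainWeight_le hα hk1 (by omega) hF hS
  have htot : ∑ f : Numbering (Fin (2 * m + 1)), chainWeight F f =
      ∑ _f : Numbering (Fin (2 * m + 1)),
        2 * ∑ d ∈ Finset.range k, (2 * m + 1).choose (m + 1 + d) := by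
    rw [sum_chainWeight, Finset.sum_const, Finset.card_univ, Fintype.card_numbering, smul_eq_mul,
      hcard]
  have heq := (Finset.sum_eq_sum_iff_of_le fun f _ ↦ (hmain f).1).1 htot
  refine Finset.eq_of_subset_of_card_le (fun A hA ↦ ?_) (by rw [card_filter_levels, hcard])
  have hpos : 0 < (Numbering.prefixed A).card := by
    rw [Numbering.card_prefixed]
    positivity
  obtain ⟨f, hf⟩ := Finset.card_pos.1 hpos
  simpa using (hmain f).2 (heq f (Finset.mem_univ f)) A
    (Finset.mem_filter.2 ⟨hA, Numbering.mem_prefixed.1 hf⟩)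
end

section
/- Let n ≥ 2 be even and let F be an intersecting antichain of subsets of [n] (i.e., intersecting and 1-Sperner) with |F| = Σ_I(n,1). Then either F = {S ⊆ [n] : |S| = n/2+1}, or there exists x ∈ [n] such that F = H_{x,n,1} = {S ⊆ [n] : |S| = n/2, x ∈ S} ∪ {S ⊆ [n] : |S| = n/2+1, x ∉ S}. -/
section Helpers

open Finset
open scoped FinsetFamily Nat

/-- Two pairs of finsets with the same cardinalities and the same intersection size are conjugate
under a permutation. -/
theorem Equiv.Perm.exists_map_eq_map_eq {α : Type*} [Fintype α] [DecidableEq α]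
    {S₁ S₂ T₁ T₂ : Finset α} (h₁ : #S₁ = #T₁) (h₂ : #S₂ = #T₂) (h : #(S₁ ∩ S₂) = #(T₁ ∩ T₂)) :
    ∃ e : Equiv.Perm α, S₁.map e.toEmbedding = T₁ ∧ S₂.map e.toEmbedding = T₂ := by
  have key : ∀ c : Bool × Bool,
      Nonempty ({a // (decide (a ∈ S₁), decide (a ∈ S₂)) = c} ≃
        {a // (decide (a ∈ T₁), decide (a ∈ T₂)) = c}) := by
    intro c
    rw [← Fintype.card_eq, Fintype.card_subtype, Fintype.card_subtype]
    have hd₁ : #(S₁ \ S₂) = #(T₁ \ T₂) := by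
      have := card_sdiff_add_card_inter S₁ S₂
      have := card_sdiff_add_card_inter T₁ T₂
      omega
    have hd₂ : #(S₂ \ S₁) = #(T₂ \ T₁) := by
      have := card_sdiff_add_card_inter S₂ S₁
      have := card_sdiff_add_card_inter T₂ T₁
      rw [inter_comm S₂, inter_comm T₂] at *
      omega
    have hc : #(S₁ ∪ S₂)ᶜ = #(T₁ ∪ T₂)ᶜ := by
      have := card_union_add_card_inter S₁ S₂
      have := card_union_add_card_inter T₁ T₂
      rw [card_compl, card_compl]
      omega
    rcases c with ⟨_ | _, _ | _⟩
    · convert hc using 2 <;> ext <;> simp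
    · convert hd₂ using 2 <;> ext <;> simp [and_comm]
    · convert hd₁ using 2 <;> ext <;> simp
    · convert h using 2 <;> ext <;> simp
  have hf := Equiv.ofFiberEquiv_map (fun c => (key c).some)
  simp only [Prod.mk.injEq, decide_eq_decide] at hf
  refine ⟨Equiv.ofFiberEquiv (fun c => (key c).some), ?_, ?_⟩
  · ext b
    rw [mem_map_equiv, ← (hf _).1, Equiv.apply_symm_apply]
  · ext b
    rw [mem_map_equiv, ← (hf _).2, Equiv.apply_symm_apply]

/-- The proportion of permutations sending a fixed `r`-set into a family of `r`-sets is the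
density of that family. -/
theorem card_perm_map_mem_mul_choose {α : Type*} [Fintype α] [DecidableEq α] {S : Finset α}
    {𝒜 : Finset (Finset α)} (h𝒜 : (𝒜 : Set (Finset α)).Sized #S) :
    #{e : Equiv.Perm α | S.map e.toEmbedding ∈ 𝒜} * (Fintype.card α).choose #S =
      #𝒜 * (Fintype.card α)! := by
  have hfib : ∀ T : Finset α, #T = #S →
      #{e : Equiv.Perm α | S.map e.toEmbedding = T} =
        #{e : Equiv.Perm α | S.map e.toEmbedding = S} := by
    intro T hT
    obtain ⟨g, hg, -⟩ := Equiv.Perm.exists_map_eq_map_eq (S₁ := T) (T₁ := S) (S₂ := ∅) (T₂ := ∅)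
      hT rfl (by simp)
    refine card_equiv (Equiv.mulLeft g) fun e => ?_
    have : S.map (g * e).toEmbedding = (S.map e.toEmbedding).map g.toEmbedding := by
      rw [map_map]; rfl
    simp only [mem_filter, mem_univ, true_and, Equiv.coe_mulLeft, this]
    rw [← map_inj (f := g.toEmbedding), hg]
  have hsum : ∀ ℬ : Finset (Finset α), (ℬ : Set (Finset α)).Sized #S →
      #{e : Equiv.Perm α | S.map e.toEmbedding ∈ ℬ} =
        #ℬ * #{e : Equiv.Perm α | S.map e.toEmbedding = S} := by
    intro ℬ hℬ
    rw [card_eq_sum_card_fiberwise (f := fun e : Equiv.Perm α => S.map e.toEmbedding) (t := ℬ)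
      (fun e he => by simpa using he), ← smul_eq_mul, ← sum_const]
    refine sum_congr rfl fun T hT => ?_
    rw [← hfib T (hℬ hT), filter_filter]
    congr 1
    ext e
    simp only [mem_filter, mem_univ, true_and, and_iff_right_iff_imp]
    rintro rfl
    exact hT
  have hall := hsum (powersetCard #S univ) (fun T hT => (mem_powersetCard.1 hT).2)
  rw [filter_true_of_mem (by simp), card_univ, Fintype.card_perm, card_powersetCard,
    card_univ] at hall
  rw [hsum 𝒜 h𝒜, hall]
  ring

/-- The positions `j, …, j + l - 1`. -/
def Fin.arc (n j l : ℕ) : Finset (Fin n) := {i | j ≤ i.val ∧ i.val < j + l}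

theorem Fin.mem_arc {n j l : ℕ} {i : Fin n} : i ∈ Fin.arc n j l ↔ j ≤ i.val ∧ i.val < j + l := by
  simp [Fin.arc]

theorem Fin.card_arc {n j l : ℕ} (h : j + l ≤ n) : #(Fin.arc n j l) = l := by
  have : (Fin.arc n j l).map Fin.valEmbedding = Ico j (j + l) := by
    ext i
    simp only [mem_map, Fin.mem_arc, Fin.valEmbedding_apply, mem_Ico]
    exact ⟨by rintro ⟨a, ha, rfl⟩; exact ha, fun hi => ⟨⟨i, by omega⟩, hi, rfl⟩⟩
  rw [← card_map, this, Nat.card_Ico]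
  omega

/-- Permutations along which the upper shadow of `𝒜` is met at position `j`, but `𝒜` is not met at
position `j + 1`. -/
def exitPerms {m : ℕ} (𝒜 : Finset (Finset (Fin (2 * m)))) (j : ℕ) :
    Finset (Equiv.Perm (Fin (2 * m))) :=
  {e | (Fin.arc _ j (m + 1)).map e.toEmbedding ∈ ∂⁺ 𝒜 ∧
    (Fin.arc _ (j + 1) m).map e.toEmbedding ∉ 𝒜}

section Exit

variable {m : ℕ} {𝒜 : Finset (Finset (Fin (2 * m)))}

theorem map_arc_mem_upShadow {i j : ℕ}
    (hj : j < m) (hi : i = j ∨ i = j + 1) {e : Equiv.Perm (Fin (2 * m))}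
    (he : (Fin.arc _ i m).map e.toEmbedding ∈ 𝒜) :
    (Fin.arc _ j (m + 1)).map e.toEmbedding ∈ ∂⁺ 𝒜 := by
  refine mem_upShadow_iff_exists_mem_card_add_one.2 ⟨_, he, map_subset_map.2 fun a => ?_, ?_⟩
  · simp only [Fin.mem_arc]
    omega
  · rw [card_map, card_map, Fin.card_arc (by omega), Fin.card_arc (by omega)]

theorem exists_mem_exitPerms (hI : Intersecting 𝒜) {e : Equiv.Perm (Fin (2 * m))}
    (he : (Fin.arc _ 0 m).map e.toEmbedding ∈ 𝒜) : ∃ j < m, e ∈ exitPerms 𝒜 j := by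
  by_contra! hcon
  have hall : ∀ j ≤ m, (Fin.arc _ j m).map e.toEmbedding ∈ 𝒜 := by
    intro j
    induction j with
    | zero => exact fun _ => he
    | succ j ih =>
      intro hj
      by_contra hne
      exact hcon j (by omega) (mem_filter.2 ⟨mem_univ _,
        map_arc_mem_upShadow (by omega) (Or.inl rfl) (ih (by omega)), hne⟩)
  obtain ⟨a, ha⟩ := hI _ he _ (hall m le_rfl)
  simp only [mem_inter, mem_map_equiv, Fin.mem_arc] at ha
  omega

theorem card_exitPerms_mul (h𝒜 : (𝒜 : Set (Finset (Fin (2 * m)))).Sized m) {j : ℕ} (hj : j < m) :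
    (#(exitPerms 𝒜 j) + #{e : Equiv.Perm (Fin (2 * m)) |
        (Fin.arc _ 0 m).map e.toEmbedding ∈ 𝒜}) * (2 * m).choose (m + 1) =
      #(∂⁺ 𝒜) * (2 * m)! := by
  have hS : ∀ i, i ≤ m → #{e : Equiv.Perm (Fin (2 * m)) |
      (Fin.arc _ i m).map e.toEmbedding ∈ 𝒜} * (2 * m).choose m = #𝒜 * (2 * m)! := by
    intro i hi
    have hc := Fin.card_arc (n := 2 * m) (j := i) (l := m) (by omega)
    have := card_perm_map_mem_mul_choose (S := Fin.arc _ i m) (𝒜 := 𝒜) (by rwa [hc])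
    rwa [hc, Fintype.card_fin] at this
  have hshift : #{e : Equiv.Perm (Fin (2 * m)) | (Fin.arc _ 0 m).map e.toEmbedding ∈ 𝒜} =
      #{e : Equiv.Perm (Fin (2 * m)) | (Fin.arc _ (j + 1) m).map e.toEmbedding ∈ 𝒜} :=
    Nat.eq_of_mul_eq_mul_right (Nat.choose_pos (by omega : m ≤ 2 * m))
      ((hS 0 (by omega)).trans (hS (j + 1) (by omega)).symm)
  have hc := Fin.card_arc (n := 2 * m) (j := j) (l := m + 1) (by omega)
  have hN := card_perm_map_mem_mul_choose (S := Fin.arc _ j (m + 1)) (𝒜 := ∂⁺ 𝒜)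
    (by rw [hc]; exact h𝒜.upShadow)
  rw [hc, Fintype.card_fin] at hN
  rw [← hN, hshift, ← card_filter_add_card_filter_not (s := {e : Equiv.Perm (Fin (2 * m)) |
    (Fin.arc _ j (m + 1)).map e.toEmbedding ∈ ∂⁺ 𝒜})
    (fun e => (Fin.arc _ (j + 1) m).map e.toEmbedding ∈ 𝒜), add_comm, filter_filter, filter_filter]
  congr 3
  ext e
  simp only [mem_filter, mem_univ, true_and, iff_and_self]
  exact map_arc_mem_upShadow hj (Or.inr rfl)

theorem card_mul_eq_of_sized (h𝒜 : (𝒜 : Set (Finset (Fin (2 * m)))).Sized m) :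
    #{e : Equiv.Perm (Fin (2 * m)) | (Fin.arc _ 0 m).map e.toEmbedding ∈ 𝒜} * (m + 1) *
      (2 * m).choose (m + 1) = #𝒜 * m * (2 * m)! := by
  have hc := Fin.card_arc (n := 2 * m) (j := 0) (l := m) (by omega)
  have h := card_perm_map_mem_mul_choose (S := Fin.arc _ 0 m) (𝒜 := 𝒜) (by rwa [hc])
  rw [hc, Fintype.card_fin] at h
  have hchoose := Nat.choose_succ_right_eq (2 * m) m
  rw [show 2 * m - m = m by omega] at hchoose
  linear_combination m * h + #{e : Equiv.Perm (Fin (2 * m)) |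
    (Fin.arc _ 0 m).map e.toEmbedding ∈ 𝒜} * hchoose

theorem sum_card_exitPerms_mul (h𝒜 : (𝒜 : Set (Finset (Fin (2 * m)))).Sized m) :
    (∑ j ∈ range m, #(exitPerms 𝒜 j)) * (2 * m).choose (m + 1) + #𝒜 * m * (2 * m)! =
      #{e : Equiv.Perm (Fin (2 * m)) | (Fin.arc _ 0 m).map e.toEmbedding ∈ 𝒜} *
        (2 * m).choose (m + 1) + #(∂⁺ 𝒜) * m * (2 * m)! := by
  have h := sum_congr (rfl : range m = range m) fun j hj =>
    card_exitPerms_mul h𝒜 (mem_range.1 hj)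
  rw [← sum_mul, sum_add_distrib, sum_const, sum_const, card_range, smul_eq_mul, smul_eq_mul] at h
  linear_combination h - card_mul_eq_of_sized h𝒜

theorem filter_subset_biUnion_exitPerms
    (hI : Intersecting 𝒜) :
    ({e | (Fin.arc _ 0 m).map e.toEmbedding ∈ 𝒜} : Finset (Equiv.Perm (Fin (2 * m)))) ⊆
      (range m).biUnion (exitPerms 𝒜) := by
  intro e he
  obtain ⟨j, hj, hej⟩ := exists_mem_exitPerms hI (mem_filter.1 he).2
  exact mem_biUnion.2 ⟨j, mem_range.2 hj, hej⟩

theorem card_le_card_upShadow_of_intersecting (hm : 0 < m)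
    (h𝒜 : (𝒜 : Set (Finset (Fin (2 * m)))).Sized m) (hI : Intersecting 𝒜) :
    #𝒜 ≤ #(∂⁺ 𝒜) := by
  have hle := (card_le_card (filter_subset_biUnion_exitPerms hI)).trans card_biUnion_le
  have hsum := sum_card_exitPerms_mul h𝒜
  have := Nat.mul_le_mul_right ((2 * m).choose (m + 1)) hle
  have hpos : 0 < m * (2 * m)! := Nat.mul_pos hm (Nat.factorial_pos _)
  refine le_of_mul_le_mul_right ?_ hpos
  rw [← mul_assoc, ← mul_assoc]
  omega

theorem map_arc_zero_mem_of_mem_exitPerms (hm : 0 < m)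
    (h𝒜 : (𝒜 : Set (Finset (Fin (2 * m)))).Sized m) (hI : Intersecting 𝒜)
    (hcard : #(∂⁺ 𝒜) ≤ #𝒜) {j : ℕ} (hj : j < m) {e : Equiv.Perm (Fin (2 * m))}
    (he : e ∈ exitPerms 𝒜 j) : (Fin.arc _ 0 m).map e.toEmbedding ∈ 𝒜 := by
  by_contra hne
  have hlt := (card_lt_card ((ssubset_iff_of_subset (filter_subset_biUnion_exitPerms hI)).2
    ⟨e, mem_biUnion.2 ⟨j, mem_range.2 hj, he⟩, by simpa using hne⟩)).trans_le card_biUnion_le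
  have hsum := sum_card_exitPerms_mul h𝒜
  have := Nat.mul_lt_mul_of_pos_right hlt (Nat.choose_pos (by omega : m + 1 ≤ 2 * m))
  have := Nat.mul_le_mul_right (m * (2 * m)!) hcard
  rw [← mul_assoc, ← mul_assoc] at this
  omega

/-- A nonempty intersecting family of `m`-subsets of a `2m`-set whose upper shadow is no larger than
the family itself is a full star. -/
theorem exists_forall_mem_iff_of_card_upShadow_le (hm : 0 < m)
    (h𝒜 : (𝒜 : Set (Finset (Fin (2 * m)))).Sized m) (hI : Intersecting 𝒜)
    (hcard : #(∂⁺ 𝒜) ≤ #𝒜) (hne : 𝒜.Nonempty) :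
    ∃ x, ∀ A, A ∈ 𝒜 ↔ #A = m ∧ x ∈ A := by
  obtain ⟨A₀, hA₀⟩ := hne
  obtain ⟨e₀, he₀, -⟩ := Equiv.Perm.exists_map_eq_map_eq (S₁ := Fin.arc (2 * m) 0 m) (T₁ := A₀)
    (S₂ := ∅) (T₂ := ∅) (by rw [Fin.card_arc (by omega), h𝒜 hA₀]) rfl (by simp)
  obtain ⟨j₀, hj₀, hexit⟩ := exists_mem_exitPerms hI (he₀ ▸ hA₀)
  obtain ⟨hB, hC⟩ := (mem_filter.1 hexit).2
  set x := e₀ ⟨j₀, by omega⟩ with hx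
  set C := (Fin.arc _ (j₀ + 1) m).map e₀.toEmbedding with hCdef
  have hCcard : #C = m := by rw [card_map, Fin.card_arc (by omega)]
  have hxC : x ∉ C := by simp [hCdef, hx, Fin.mem_arc]
  have hinsert : ∀ (j : ℕ) (hj : j < m) (e : Equiv.Perm (Fin (2 * m))),
      (Fin.arc _ j (m + 1)).map e.toEmbedding =
        insert (e ⟨j, by omega⟩) ((Fin.arc _ (j + 1) m).map e.toEmbedding) := by
    intro j hj e
    rw [← Equiv.coe_toEmbedding, ← map_insert]
    congr 1
    ext i
    simp only [Fin.mem_arc, mem_insert, Fin.ext_iff]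
    omega
  rw [hinsert j₀ hj₀, ← hx, ← hCdef] at hB
  have hstar : ∀ A : Finset (Fin (2 * m)), #A = m → x ∈ A → A ∈ 𝒜 := by
    intro A hA hxA
    have hpos : 0 < #(A \ C) := card_pos.2 ⟨x, mem_sdiff.2 ⟨hxA, hxC⟩⟩
    have hsd := card_sdiff_add_card_inter A C
    obtain ⟨j, hj⟩ : ∃ j, #(A \ C) = j + 1 := ⟨_, (Nat.sub_add_cancel hpos).symm⟩
    have hjm : j < m := by omega
    have hinter : Fin.arc (2 * m) 0 m ∩ Fin.arc (2 * m) (j + 1) m =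
        Fin.arc (2 * m) (j + 1) (m - (j + 1)) := by
      ext i
      simp only [mem_inter, Fin.mem_arc]
      omega
    obtain ⟨e, heA, heC⟩ := Equiv.Perm.exists_map_eq_map_eq (S₁ := Fin.arc (2 * m) 0 m) (T₁ := A)
      (S₂ := Fin.arc (2 * m) (j + 1) m) (T₂ := C) (by rw [Fin.card_arc (by omega), hA])
      (by rw [Fin.card_arc (by omega), hCcard])
      (by rw [hinter, Fin.card_arc (by omega)]; omega)
    set p : Fin (2 * m) := ⟨j, by omega⟩ with hp
    have hpA : e p ∈ A := by
      rw [← heA]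
      simp [Fin.mem_arc, hp, hjm]
    have hpC : e p ∉ C := by
      rw [← heC]
      simp [Fin.mem_arc, hp]
    have hmap : ∀ S T : Finset (Fin (2 * m)), S.map e.toEmbedding = T → (e p ∈ T ↔ x ∈ T) →
        S.map (e.trans (Equiv.swap (e p) x)).toEmbedding = T := by
      rintro S T rfl hT
      ext b
      rw [mem_map_equiv, Equiv.symm_trans_apply, Equiv.symm_swap, ← mem_map_equiv]
      by_cases h₁ : b = e p
      · subst h₁
        simpa using hT.symm
      · by_cases h₂ : b = x
        · subst h₂
          simpa using hT
        · rw [Equiv.swap_apply_of_ne_of_ne h₁ h₂]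
    have heA' := hmap _ _ heA (iff_of_true hpA hxA)
    have heC' := hmap _ _ heC (iff_of_false hpC hxC)
    rw [← heA']
    refine map_arc_zero_mem_of_mem_exitPerms hm h𝒜 hI hcard hjm (mem_filter.2 ⟨mem_univ _, ?_, ?_⟩)
    · rw [hinsert j hjm, heC']
      simpa [← hp] using hB
    · rwa [heC']
  refine ⟨x, fun A => ⟨fun hA => ⟨h𝒜 hA, ?_⟩, fun hA => hstar A hA.1 hA.2⟩⟩
  by_contra hxA
  have hAc : Aᶜ ∈ 𝒜 := hstar _ (by rw [card_compl, Fintype.card_fin, h𝒜 hA]; omega) (by simpa)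
  simpa using hI _ hA _ hAc

end Exit

/-- Local LYM inequality for the upper shadow. -/
theorem card_mul_le_card_upShadow_mul {α : Type*} [Fintype α] [DecidableEq α] {r : ℕ}
    {𝒜 : Finset (Finset α)} (h𝒜 : (𝒜 : Set (Finset α)).Sized r) (hr : r ≤ Fintype.card α) :
    #𝒜 * (Fintype.card α - r) ≤ #(∂⁺ 𝒜) * (r + 1) := by
  have h : ((𝒜ᶜˢ : Finset (Finset α)) : Set (Finset α)).Sized (Fintype.card α - r) := by
    intro A hA
    rw [mem_coe, mem_compls] at hA
    have := h𝒜 hA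
    rw [card_compl] at this
    have := card_le_univ A
    omega
  have := card_mul_le_card_shadow_mul h
  rwa [shadow_compls, card_compls, card_compls, Nat.sub_sub_self hr] at this

section Antichain

variable {m : ℕ} {F : Finset (Finset (Fin (2 * m)))}

theorem kSperner_one_iff {α : Type*} {F : Finset (Finset α)} :
    KSperner 1 F ↔ IsAntichain (· ⊆ ·) (F : Set (Finset α)) := by
  constructor
  · intro h A hA B hB hne hAB
    refine h ⟨![A, B], ?_, ?_⟩
    · intro i
      fin_cases i
      · exact hA
      · exact hB
    · rw [Fin.strictMono_iff_lt_succ]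
      intro i
      fin_cases i
      exact lt_of_le_of_ne hAB hne
  · rintro h ⟨c, hc, hmono⟩
    have hlt : c 0 < c 1 := hmono (by decide)
    exact h (hc 0) (hc 1) hlt.ne hlt.le

theorem exists_card_lt_of_card_lt (hI : Intersecting F)
    (hA : IsAntichain (· ⊆ ·) (F : Set (Finset (Fin (2 * m)))))
    (h : ∃ A ∈ F, #A < m) :
    ∃ G : Finset (Finset (Fin (2 * m))), Intersecting G ∧
      IsAntichain (· ⊆ ·) (G : Set (Finset (Fin (2 * m)))) ∧ #F < #G := by
  obtain ⟨A₀, hA₀, hmin⟩ := exists_min_image F card (h.imp fun _ h => h.1)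
  obtain ⟨A₁, hA₁, hlt⟩ := h
  have hr : #A₀ < m := (hmin _ hA₁).trans_lt hlt
  set r := #A₀
  have hsized : ((F # r : Finset (Finset (Fin (2 * m)))) : Set (Finset (Fin (2 * m)))).Sized r :=
    sized_slice
  have hpos : 0 < #(F # r) := card_pos.2 ⟨A₀, mem_slice.2 ⟨hA₀, rfl⟩⟩
  have hlym := card_mul_le_card_upShadow_mul hsized (by rw [Fintype.card_fin]; omega)
  rw [Fintype.card_fin] at hlym
  have hcard : #(F # r) < #(∂⁺ (F # r)) := by
    have h₁ : #(F # r) * (r + 1) < #(F # r) * (2 * m - r) :=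
      Nat.mul_lt_mul_of_pos_left (by omega) hpos
    exact lt_of_mul_lt_mul_right (h₁.trans_le hlym) (Nat.zero_le _)
  have hsup : ∀ B ∈ (F \ F # r) ∪ ∂⁺ (F # r), ∃ A ∈ F, A ⊆ B := by
    intro B hB
    rcases mem_union.1 hB with hB | hB
    · exact ⟨B, (mem_sdiff.1 hB).1, Subset.rfl⟩
    · obtain ⟨A, hA', hAB⟩ := exists_subset_of_mem_upShadow hB
      exact ⟨A, slice_subset hA', hAB⟩
  have hN : ∀ B ∈ ∂⁺ (F # r), #B = r + 1 := fun B hB => hsized.upShadow hB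
  have hbig : ∀ B ∈ F \ F # r, r + 1 ≤ #B := by
    intro B hB
    rw [mem_sdiff, mem_slice] at hB
    have := hmin B hB.1
    have : #B ≠ r := fun h => hB.2 ⟨hB.1, h⟩
    omega
  have hnot : ∀ B ∈ ∂⁺ (F # r), ∀ C ∈ F, ¬ B ⊆ C := by
    intro B hB C hC hBC
    obtain ⟨A, hA', hAB⟩ := exists_subset_of_mem_upShadow hB
    have hAC := hA.eq (slice_subset hA') hC (hAB.trans hBC)
    have := card_le_card hBC
    rw [hN B hB, ← hAC, hsized hA'] at this
    omega
  refine ⟨(F \ F # r) ∪ ∂⁺ (F # r), ?_, ?_, ?_⟩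
  · intro B hB C hC
    obtain ⟨B', hB', hBB'⟩ := hsup B hB
    obtain ⟨C', hC', hCC'⟩ := hsup C hC
    exact (hI B' hB' C' hC').mono (inter_subset_inter hBB' hCC')
  · intro B hB C hC hne hBC
    rcases mem_union.1 hC with hC | hC
    · rcases mem_union.1 hB with hB | hB
      · exact hA (mem_sdiff.1 hB).1 (mem_sdiff.1 hC).1 hne hBC
      · exact hnot B hB C (mem_sdiff.1 hC).1 hBC
    · refine hne (eq_of_subset_of_card_le hBC ?_)
      rw [hN C hC]
      rcases mem_union.1 hB with hB | hB
      · exact hbig B hB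
      · exact (hN B hB).ge
  · rw [card_union_of_disjoint (disjoint_left.2 fun B hB hB' =>
      hnot B hB' B (mem_sdiff.1 hB).1 Subset.rfl)]
    have := card_sdiff_add_card_eq_card (slice_subset : F # r ⊆ F)
    omega

theorem exists_card_lt_of_lt_card (hm : ∀ A ∈ F, m ≤ #A)
    (hA : IsAntichain (· ⊆ ·) (F : Set (Finset (Fin (2 * m)))))
    (hI : Intersecting F) (h : ∃ A ∈ F, m + 1 < #A) :
    ∃ G : Finset (Finset (Fin (2 * m))), Intersecting G ∧
      IsAntichain (· ⊆ ·) (G : Set (Finset (Fin (2 * m)))) ∧ #F < #G := by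
  obtain ⟨A₀, hA₀, hmax⟩ := exists_max_image F card (h.imp fun _ h => h.1)
  obtain ⟨A₁, hA₁, hlt⟩ := h
  have hr : m + 1 < #A₀ := hlt.trans_le (hmax _ hA₁)
  have hr' : #A₀ ≤ 2 * m := (card_le_univ _).trans_eq (Fintype.card_fin _)
  set r := #A₀
  have hsized : ((F # r : Finset (Finset (Fin (2 * m)))) : Set (Finset (Fin (2 * m)))).Sized r :=
    sized_slice
  have hpos : 0 < #(F # r) := card_pos.2 ⟨A₀, mem_slice.2 ⟨hA₀, rfl⟩⟩
  have hlym := card_mul_le_card_shadow_mul hsized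
  rw [Fintype.card_fin] at hlym
  have hcard : #(F # r) < #(∂ (F # r)) := by
    have h₁ : #(F # r) * (2 * m - r + 1) < #(F # r) * r :=
      Nat.mul_lt_mul_of_pos_left (by omega) hpos
    exact lt_of_mul_lt_mul_right (h₁.trans_le hlym) (Nat.zero_le _)
  have hN : ∀ B ∈ ∂ (F # r), #B = r - 1 := fun B hB => hsized.shadow hB
  have hsmall : ∀ B ∈ F \ F # r, #B ≤ r - 1 := by
    intro B hB
    rw [mem_sdiff, mem_slice] at hB
    have := hmax B hB.1
    have : #B ≠ r := fun h => hB.2 ⟨hB.1, h⟩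
    omega
  have hnot : ∀ B ∈ ∂ (F # r), ∀ C ∈ F, ¬ C ⊆ B := by
    intro B hB C hC hCB
    obtain ⟨A, hA', hBA⟩ := exists_subset_of_mem_shadow hB
    have hCA := hA.eq hC (slice_subset hA') (hCB.trans hBA)
    have := card_le_card hCB
    rw [hN B hB, hCA, hsized hA'] at this
    omega
  have hinter : ∀ B C : Finset (Fin (2 * m)), m + 1 ≤ #B → m ≤ #C → (B ∩ C).Nonempty := by
    intro B C hB hC
    rw [← card_pos]
    have h₁ := card_union_add_card_inter B C
    have h₂ := card_le_univ (B ∪ C)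
    rw [Fintype.card_fin] at h₂
    omega
  refine ⟨(F \ F # r) ∪ ∂ (F # r), ?_, ?_, ?_⟩
  · intro B hB C hC
    rcases mem_union.1 hB with hB | hB <;> rcases mem_union.1 hC with hC | hC
    · exact hI B (mem_sdiff.1 hB).1 C (mem_sdiff.1 hC).1
    · rw [inter_comm]
      exact hinter C B (by have := hN C hC; omega) (hm B (mem_sdiff.1 hB).1)
    · exact hinter B C (by have := hN B hB; omega) (hm C (mem_sdiff.1 hC).1)
    · exact hinter B C (by have := hN B hB; omega) (by have := hN C hC; omega)
  · intro B hB C hC hne hBC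
    rcases mem_union.1 hB with hB | hB
    · rcases mem_union.1 hC with hC | hC
      · exact hA (mem_sdiff.1 hB).1 (mem_sdiff.1 hC).1 hne hBC
      · exact hnot C hC B (mem_sdiff.1 hB).1 hBC
    · refine hne (eq_of_subset_of_card_le hBC ?_)
      rw [hN B hB]
      rcases mem_union.1 hC with hC | hC
      · exact hsmall C hC
      · exact (hN C hC).le
  · rw [card_union_of_disjoint (disjoint_left.2 fun B hB hB' =>
      hnot B hB' B (mem_sdiff.1 hB).1 Subset.rfl)]
    have := card_sdiff_add_card_eq_card (slice_subset : F # r ⊆ F)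
    omega

theorem disjoint_slice_succ_upShadow_and_union_subset
    (hA : IsAntichain (· ⊆ ·) (F : Set (Finset (Fin (2 * m))))) :
    Disjoint (F # (m + 1)) (∂⁺ (F # m)) ∧
      (F # (m + 1)) ∪ ∂⁺ (F # m) ⊆ powersetCard (m + 1) univ := by
  refine ⟨disjoint_left.2 fun B hB hB' => ?_, union_subset (fun B hB => ?_) fun B hB => ?_⟩
  · obtain ⟨A, hA', hAB⟩ := exists_subset_of_mem_upShadow hB'
    have := hA.eq (slice_subset hA') (slice_subset hB) hAB
    have := sized_slice hA'
    have := sized_slice hB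
    subst A
    omega
  · exact mem_powersetCard.2 ⟨subset_univ _, sized_slice hB⟩
  · exact mem_powersetCard.2 ⟨subset_univ _, sized_slice.upShadow hB⟩

theorem card_eq_card_slice_add_card_slice (h : ∀ A ∈ F, #A = m ∨ #A = m + 1) :
    #F = #(F # m) + #(F # (m + 1)) := by
  rw [← card_union_of_disjoint]
  · congr 1
    ext A
    simp only [mem_union, mem_slice, ← and_or_left]
    exact ⟨fun hA => ⟨hA, h A hA⟩, fun hA => hA.1⟩
  · refine disjoint_left.2 fun B hB hB' => ?_
    have := sized_slice hB
    have := sized_slice hB'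
    omega

theorem Intersecting.slice (hI : Intersecting F) (r : ℕ) : Intersecting (F # r) :=
  fun A hA B hB => hI A (slice_subset hA) B (slice_subset hB)

theorem card_le_choose_of_two_levels (hm : 0 < m) (hI : Intersecting F)
    (hA : IsAntichain (· ⊆ ·) (F : Set (Finset (Fin (2 * m)))))
    (h : ∀ A ∈ F, #A = m ∨ #A = m + 1) : #F ≤ (2 * m).choose (m + 1) := by
  obtain ⟨hdisj, hsub⟩ := disjoint_slice_succ_upShadow_and_union_subset hA
  have h₁ := card_le_card hsub
  rw [card_union_of_disjoint hdisj, card_powersetCard, card_univ, Fintype.card_fin] at h₁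
  have := card_le_card_upShadow_of_intersecting hm sized_slice (hI.slice m)
  have := card_eq_card_slice_add_card_slice h
  omega

theorem card_eq_or_eq_of_maximal (hI : Intersecting F)
    (hA : IsAntichain (· ⊆ ·) (F : Set (Finset (Fin (2 * m)))))
    (hmax : ∀ G : Finset (Finset (Fin (2 * m))), Intersecting G →
      IsAntichain (· ⊆ ·) (G : Set (Finset (Fin (2 * m)))) → #G ≤ #F) :
    ∀ A ∈ F, #A = m ∨ #A = m + 1 := by
  have h₁ : ∀ A ∈ F, m ≤ #A := by
    by_contra! h
    obtain ⟨G, hG, hG', hlt⟩ := exists_card_lt_of_card_lt hI hA h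
    exact (hmax G hG hG').not_gt hlt
  have h₂ : ∀ A ∈ F, #A ≤ m + 1 := by
    by_contra! h
    obtain ⟨G, hG, hG', hlt⟩ := exists_card_lt_of_lt_card h₁ hA hI h
    exact (hmax G hG hG').not_gt hlt
  intro A hA
  have := h₁ A hA
  have := h₂ A hA
  omega

/-- An intersecting antichain on a `2m`-set has at most `(2m).choose (m + 1)` members. -/
theorem card_le_choose_of_intersecting_antichain (hm : 0 < m) (hI : Intersecting F)
    (hA : IsAntichain (· ⊆ ·) (F : Set (Finset (Fin (2 * m))))) :
    #F ≤ (2 * m).choose (m + 1) := by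
  classical
  obtain ⟨G, hG, hmax⟩ := exists_max_image
    {G : Finset (Finset (Fin (2 * m))) | Intersecting G ∧
      IsAntichain (· ⊆ ·) (G : Set (Finset (Fin (2 * m))))} card ⟨F, by simp [hI, hA]⟩
  simp only [mem_filter, mem_univ, true_and] at hG hmax
  exact (hmax F ⟨hI, hA⟩).trans (card_le_choose_of_two_levels hm hG.1 hG.2
    (card_eq_or_eq_of_maximal hG.1 hG.2 fun H h₁ h₂ => hmax H ⟨h₁, h₂⟩))

/-- The extremal intersecting antichains on a `2m`-set. -/
theorem eq_of_card_eq_choose (hm : 0 < m) (hI : Intersecting F)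
    (hA : IsAntichain (· ⊆ ·) (F : Set (Finset (Fin (2 * m)))))
    (hcard : #F = (2 * m).choose (m + 1)) :
    F = ({S | #S = m + 1} : Finset (Finset (Fin (2 * m)))) ∨
      ∃ x, F = ({S | (#S = m ∧ x ∈ S) ∨ (#S = m + 1 ∧ x ∉ S)} :
        Finset (Finset (Fin (2 * m)))) := by
  have hlev := card_eq_or_eq_of_maximal hI hA fun G hG hG' =>
    (card_le_choose_of_intersecting_antichain hm hG hG').trans_eq hcard.symm
  obtain ⟨hdisj, hsub⟩ := disjoint_slice_succ_upShadow_and_union_subset hA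
  have hle := card_le_card hsub
  have hadd := card_union_of_disjoint hdisj
  have hpow : #(powersetCard (m + 1) (univ : Finset (Fin (2 * m)))) = (2 * m).choose (m + 1) := by
    rw [card_powersetCard, card_univ, Fintype.card_fin]
  have hshadow := card_le_card_upShadow_of_intersecting hm sized_slice (hI.slice m)
  have hF := card_eq_card_slice_add_card_slice hlev
  have htop := eq_of_subset_of_card_le hsub (by omega)
  have hmem : ∀ S : Finset (Fin (2 * m)), #S = m + 1 → S ∈ F ∨ S ∈ ∂⁺ (F # m) := by
    intro S hS
    have : S ∈ (F # (m + 1)) ∪ ∂⁺ (F # m) := by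
      rw [htop]
      exact mem_powersetCard.2 ⟨subset_univ _, hS⟩
    exact (mem_union.1 this).imp_left fun h => slice_subset h
  rcases (F # m).eq_empty_or_nonempty with hempty | hne
  · left
    ext S
    simp only [mem_filter, mem_univ, true_and]
    refine ⟨fun hS => (hlev S hS).resolve_left fun h => ?_, fun hS => ?_⟩
    · simpa [hempty] using mem_slice.2 ⟨hS, h⟩
    · simpa [hempty] using hmem S hS
  · right
    obtain ⟨x, hx⟩ := exists_forall_mem_iff_of_card_upShadow_le hm sized_slice (hI.slice m)
      (by omega) hne
    refine ⟨x, ?_⟩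
    ext S
    simp only [mem_filter, mem_univ, true_and]
    constructor
    · intro hS
      rcases hlev S hS with h | h
      · exact Or.inl ((hx S).1 (mem_slice.2 ⟨hS, h⟩))
      · refine Or.inr ⟨h, fun hxS => ?_⟩
        obtain ⟨T, hxT, hTS, hT⟩ := exists_subsuperset_card_eq (singleton_subset_iff.2 hxS)
          (n := m) (by rw [card_singleton]; omega) (by omega)
        have hTF := slice_subset ((hx T).2 ⟨hT, singleton_subset_iff.1 hxT⟩)
        have := hA.eq hTF hS hTS
        subst this
        omega
    · rintro (h | ⟨hS, hxS⟩)
      · exact slice_subset ((hx S).2 h)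
      · refine (hmem S hS).resolve_right fun h => ?_
        obtain ⟨T, hT, hTS⟩ := exists_subset_of_mem_upShadow h
        exact hxS (hTS ((hx T).1 hT).2)

end Antichain

end Helpers

theorem intersecting_antichain_eq_even (n : ℕ) (hn : 2 ≤ n) (heven : n % 2 = 0)
    (F : Finset (Finset (Fin n))) (hF : Intersecting F) (hS : KSperner 1 F)
    (hcard : F.card = Nat.choose (n - 1) (n / 2 - 1) + Nat.choose (n - 1) (n / 2 + 1)) :
    F = Finset.univ.filter (fun S : Finset (Fin n) => S.card = n / 2 + 1) ∨
      ∃ x : Fin n, F = Finset.univ.filter (fun S : Finset (Fin n) =>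
        (S.card = n / 2 ∧ x ∈ S) ∨ (S.card = n / 2 + 1 ∧ x ∉ S)) := by
  obtain ⟨m, rfl⟩ : ∃ m, n = 2 * m := ⟨n / 2, by omega⟩
  obtain ⟨k, rfl⟩ : ∃ k, m = k + 1 := ⟨m - 1, by omega⟩
  rw [show 2 * (k + 1) / 2 = k + 1 by omega] at hcard ⊢
  refine eq_of_card_eq_choose k.succ_pos hF (kSperner_one_iff.1 hS) (hcard.trans ?_)
  rw [show 2 * (k + 1) - 1 = 2 * k + 1 by omega, show k + 1 - 1 = k by omega,
    show 2 * (k + 1) = 2 * k + 1 + 1 by omega, Nat.choose_succ_succ' (2 * k + 1) (k + 1),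
    Nat.choose_symm_half]
end

section
/- Let G be a family of intervals in Z/nZ such that G is an antichain under inclusion, any two members of G intersect, and every member of G has size at most n/2. Then |G| ≤ n/2. -/
/-- `S ⊆ ZMod n` is an interval if it is `{i, i+1, …, i+j-1}` for some
`i : ZMod n` and `1 ≤ j ≤ n`. -/
def IsInterval (n : ℕ) (S : Finset (ZMod n)) : Prop :=
  ∃ (i : ZMod n) (j : ℕ), 1 ≤ j ∧ j ≤ n ∧
    S = (Finset.range j).image (fun t : ℕ => i + (t : ZMod n))

/-- The interval `A_i^j = {i, i+1, …, i+j-1}` in `ZMod n`. -/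
def IntervalA (n : ℕ) (i : ZMod n) (j : ℕ) : Finset (ZMod n) :=
  (Finset.range j).image (fun t : ℕ => i + (t : ZMod n))

theorem mem_intervalA {n : ℕ} {i x : ZMod n} {j : ℕ} :
    x ∈ IntervalA n i j ↔ ∃ t < j, i + (t : ZMod n) = x := by
  simp [IntervalA]

theorem card_intervalA {n : ℕ} (i : ZMod n) {j : ℕ} (hj : j ≤ n) :
    (IntervalA n i j).card = j := by
  rw [IntervalA, Finset.card_image_of_injOn, Finset.card_range]
  intro s hs t ht hst
  simp only [Finset.coe_range, Set.mem_Iio] at hs ht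
  have h : (s : ZMod n) = t := add_left_cancel hst
  rw [ZMod.natCast_eq_natCast_iff] at h
  exact h.eq_of_lt_of_lt (by omega) (by omega)

theorem intervalA_subset_of_start_eq {n : ℕ} (i : ZMod n) {j k : ℕ} (hjk : j ≤ k) :
    IntervalA n i j ⊆ IntervalA n i k := by
  intro x hx
  obtain ⟨t, ht, rfl⟩ := mem_intervalA.1 hx
  exact mem_intervalA.2 ⟨t, by omega, rfl⟩

/-- If one interval starts `u` places after another and does not reach further, it is contained
in it. -/
theorem intervalA_add_subset {n : ℕ} (i : ZMod n) {u j k : ℕ} (h : u + j ≤ k) :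
    IntervalA n (i + (u : ZMod n)) j ⊆ IntervalA n i k := by
  intro x hx
  obtain ⟨t, ht, rfl⟩ := mem_intervalA.1 hx
  exact mem_intervalA.2 ⟨u + t, by omega, by push_cast; ring⟩

theorem intervalA_subset_of_end_eq {n : ℕ} {a b : ZMod n} {j k : ℕ} (hjk : j ≤ k)
    (h : a + (j : ZMod n) = b + (k : ZMod n)) : IntervalA n a j ⊆ IntervalA n b k := by
  have ha : a = b + ((k - j : ℕ) : ZMod n) := by
    rw [Nat.cast_sub hjk]
    linear_combination h
  rw [ha]
  exact intervalA_add_subset b (by omega)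

theorem disjoint_intervalA_add {n : ℕ} (b : ZMod n) {j k : ℕ} (hjk : j + k ≤ n) :
    Disjoint (IntervalA n (b + (k : ZMod n)) j) (IntervalA n b k) := by
  rw [Finset.disjoint_left]
  intro x hx hy
  obtain ⟨s, hs, rfl⟩ := mem_intervalA.1 hx
  obtain ⟨t, ht, hst⟩ := mem_intervalA.1 hy
  have h : (t : ZMod n) = ((k + s : ℕ) : ZMod n) := by
    push_cast
    linear_combination hst
  rw [ZMod.natCast_eq_natCast_iff] at h
  have := h.eq_of_lt_of_lt (by omega) (by omega)
  omega

/-- If two intervals meet and the first does not start inside the second, then either the first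
contains the second or the point following the first lies in the second. -/
theorem intervalA_subset_or_end_mem {n : ℕ} {a b : ZMod n} {j k : ℕ}
    (hmeet : (IntervalA n a j ∩ IntervalA n b k).Nonempty) (ha : a ∉ IntervalA n b k) :
    IntervalA n b k ⊆ IntervalA n a j ∨ a + (j : ZMod n) ∈ IntervalA n b k := by
  obtain ⟨x, hx⟩ := hmeet
  rw [Finset.mem_inter] at hx
  obtain ⟨v, hv, rfl⟩ := mem_intervalA.1 hx.1
  obtain ⟨w, hw, hvw⟩ := mem_intervalA.1 hx.2
  rcases le_or_gt w v with h | h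
  · have hb : b = a + ((v - w : ℕ) : ZMod n) := by
      rw [Nat.cast_sub h]
      linear_combination hvw
    rcases le_or_gt (v - w + k) j with h' | h'
    · left
      rw [hb]
      exact intervalA_add_subset a h'
    · right
      refine mem_intervalA.2 ⟨j - (v - w), by omega, ?_⟩
      rw [hb, Nat.cast_sub (by omega : v - w ≤ j)]
      ring
  · refine absurd (mem_intervalA.2 ⟨w - v, by omega, ?_⟩) ha
    rw [Nat.cast_sub h.le]
    linear_combination hvw


theorem intersecting_antichain_intervals_card_le (n : ℕ) (hn : 0 < n)
    (G : Finset (Finset (ZMod n)))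
    (hint : ∀ S ∈ G, IsInterval n S)
    (hanti : ∀ S ∈ G, ∀ T ∈ G, S ⊆ T → S = T)
    (hmeet : Intersecting G)
    (hsize : ∀ S ∈ G, 2 * S.card ≤ n) :
    2 * G.card ≤ n := by
  classical
  rcases G.eq_empty_or_nonempty with rfl | ⟨S, hS⟩
  · simp
  have hrep : ∀ T, ∃ (i : ZMod n) (j : ℕ), T ∈ G → 1 ≤ j ∧ 2 * j ≤ n ∧ T = IntervalA n i j := by
    intro T
    by_cases hT : T ∈ G
    · obtain ⟨i, j, h1, hj, rfl⟩ := hint T hT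
      have hcard := hsize _ hT
      change 2 * (IntervalA n i j).card ≤ n at hcard
      rw [card_intervalA i hj] at hcard
      exact ⟨i, j, fun _ => ⟨h1, hcard, rfl⟩⟩
    · exact ⟨0, 0, fun h => absurd h hT⟩
  choose a l h using hrep
  have eq_of_start : ∀ T ∈ G, ∀ U ∈ G, a T = a U → T = U := by
    intro T hT U hU hTU
    rcases le_total (l T) (l U) with hl | hl
    · apply hanti T hT U hU
      rw [(h T hT).2.2, (h U hU).2.2, hTU]
      exact intervalA_subset_of_start_eq _ hl
    · apply Eq.symm
      apply hanti U hU T hT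
      rw [(h T hT).2.2, (h U hU).2.2, hTU]
      exact intervalA_subset_of_start_eq _ hl
  have eq_of_end : ∀ T ∈ G, ∀ U ∈ G, a T + (l T : ZMod n) = a U + (l U : ZMod n) → T = U := by
    intro T hT U hU hTU
    rcases le_total (l T) (l U) with hl | hl
    · apply hanti T hT U hU
      rw [(h T hT).2.2, (h U hU).2.2]
      exact intervalA_subset_of_end_eq hl hTU
    · apply Eq.symm
      apply hanti U hU T hT
      rw [(h T hT).2.2, (h U hU).2.2]
      exact intervalA_subset_of_end_eq hl hTU.symm
  have start_ne_end : ∀ T ∈ G, ∀ U ∈ G, a T ≠ a U + (l U : ZMod n) := by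
    intro T hT U hU hTU
    obtain ⟨-, hlT, hTeq⟩ := h T hT
    obtain ⟨-, hlU, hUeq⟩ := h U hU
    have hd := disjoint_intervalA_add (a U) (by omega : l T + l U ≤ n)
    rw [← hTU, ← hTeq, ← hUeq, Finset.disjoint_iff_inter_eq_empty] at hd
    exact (hmeet T hT U hU).ne_empty hd
  have hle : G.card ≤ S.card := by
    refine Finset.card_le_card_of_injOn
      (fun T => if a T ∈ S then a T else a T + (l T : ZMod n)) ?_ ?_
    · intro T hT
      rw [Finset.mem_coe] at hT
      dsimp only
      split_ifs with haT
      · exact haT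
      · have hTeq := (h T hT).2.2
        obtain ⟨h1, -, hSeq⟩ := h S hS
        have hm := hmeet T hT S hS
        have hor : S ⊆ T ∨ a T + (l T : ZMod n) ∈ S := by
          have := @intervalA_subset_or_end_mem n (a T) (a S) (l T) (l S)
          rw [← hTeq, ← hSeq] at this
          exact this hm haT
        refine hor.resolve_left fun hST => haT ?_
        rw [← hanti S hS T hT hST]
        have hmem : a S ∈ IntervalA n (a S) (l S) := mem_intervalA.2 ⟨0, h1, by simp⟩
        rwa [← hSeq] at hmem
    · intro T hT U hU hTU
      rw [Finset.mem_coe] at hT hU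
      dsimp only at hTU
      split_ifs at hTU
      · exact eq_of_start T hT U hU hTU
      · exact absurd hTU (start_ne_end T hT U hU)
      · exact absurd hTU.symm (start_ne_end U hU T hT)
      · exact eq_of_end T hT U hU hTU
  have := hsize S hS
  omega
end

section
/- Let G be a family of intervals in Z/nZ that is an antichain under inclusion, satisfies |G| = n−1, and contains intervals of at least two distinct sizes. Then G is pair-contiguous: there exist j with 1 ≤ j < n, i ∈ Z/nZ, and s with 0 ≤ s ≤ n−2 such that G consists exactly of the intervals A_i^j, A_{i+1}^j, …, A_{i+s}^j of size j together with the intervals A_{i+s+1}^{j+1}, A_{i+s+2}^{j+1}, …, A_{i−2}^{j+1} of size j+1, where A_t^m denotes the interval {t, t+1, …, t+m−1}. -/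
theorem intervalA_subset {n : ℕ} (i : ZMod n) {d j k : ℕ} (h : d + j ≤ k) :
    IntervalA n (i + d) j ⊆ IntervalA n i k := by
  intro x hx
  simp only [IntervalA, Finset.mem_image, Finset.mem_range] at hx ⊢
  obtain ⟨t, ht, rfl⟩ := hx
  exact ⟨d + t, by omega, by push_cast; ring⟩

/-- In an antichain, moving the starting point by `d` lowers the size by less than `d`. -/
theorem size_lt_of_antichain {n : ℕ} {G : Finset (Finset (ZMod n))}
    (hanti : ∀ S ∈ G, ∀ T ∈ G, S ⊆ T → S = T) (i : ZMod n) {d j k : ℕ} (hd : 0 < d)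
    (hj : j ≤ n) (hk : k ≤ n) (h₁ : IntervalA n (i + d) j ∈ G) (h₂ : IntervalA n i k ∈ G) :
    k < d + j := by
  by_contra! hle
  have h := congrArg Finset.card (hanti _ h₁ _ h₂ (intervalA_subset i hle))
  rw [card_intervalA _ hj, card_intervalA _ hk] at h
  omega

theorem intervalA_eq_of_antichain {n : ℕ} {G : Finset (Finset (ZMod n))}
    (hanti : ∀ S ∈ G, ∀ T ∈ G, S ⊆ T → S = T) (i : ZMod n) {j k : ℕ}
    (h₁ : IntervalA n i j ∈ G) (h₂ : IntervalA n i k ∈ G) :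
    IntervalA n i j = IntervalA n i k := by
  rcases le_total j k with h | h
  · exact hanti _ h₁ _ h₂ (by simpa using intervalA_subset i (d := 0) (by simpa using h))
  · exact (hanti _ h₂ _ h₁ (by simpa using intervalA_subset i (d := 0) (by simpa using h))).symm

/-- An antichain of `n - 1` intervals is listed by the starting points `i, i + 1, …, i + (n - 2)`
for some `i`. -/
theorem exists_size_function {n : ℕ} (hn : 0 < n) {G : Finset (Finset (ZMod n))}
    (hint : ∀ S ∈ G, IsInterval n S) (hanti : ∀ S ∈ G, ∀ T ∈ G, S ⊆ T → S = T)
    (hcard : G.card = n - 1) :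
    ∃ (i : ZMod n) (g : ℕ → ℕ),
      (∀ k < n - 1, 1 ≤ g k ∧ g k ≤ n ∧ IntervalA n (i + k) (g k) ∈ G) ∧
      ∀ S ∈ G, ∃ k < n - 1, S = IntervalA n (i + k) (g k) := by
  have : NeZero n := ⟨hn.ne'⟩
  choose! start size hpos hle heq using hint
  change ∀ S ∈ G, S = IntervalA n (start S) (size S) at heq
  have hmem : ∀ S ∈ G, IntervalA n (start S) (size S) ∈ G := fun S hS => heq S hS ▸ hS
  have hinj : Set.InjOn start G := by
    intro S hS T hT h
    rw [heq S hS, heq T hT, h]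
    exact intervalA_eq_of_antichain hanti _ (h ▸ hmem S hS) (hmem T hT)
  obtain ⟨p, hp⟩ : ∃ p, (G.image start)ᶜ = {p} := by
    rw [← Finset.card_eq_one, Finset.card_compl, Finset.card_image_of_injOn hinj, ZMod.card, hcard]
    omega
  have hstart : ∀ x, x ≠ p ↔ ∃ S ∈ G, start S = x := by
    intro x
    rw [← Finset.mem_image, ← not_iff_not, ← Finset.mem_compl, hp]
    simp
  have hne : ∀ k < n - 1, p + 1 + (k : ZMod n) ≠ p := by
    intro k hk h
    have h' : ((k + 1 : ℕ) : ZMod n) = 0 := by push_cast; linear_combination h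
    have := Nat.le_of_dvd (by omega) ((ZMod.natCast_eq_zero_iff _ _).1 h')
    omega
  have hex : ∀ k < n - 1, ∃ m, 1 ≤ m ∧ m ≤ n ∧ IntervalA n (p + 1 + k) m ∈ G := by
    intro k hk
    obtain ⟨S, hS, h⟩ := (hstart _).1 (hne k hk)
    exact ⟨size S, hpos S hS, hle S hS, h ▸ hmem S hS⟩
  choose! g hg using hex
  refine ⟨p + 1, g, hg, fun S hS => ?_⟩
  have hval : ((start S - p - 1).val : ZMod n) = start S - p - 1 := ZMod.natCast_zmod_val _
  have hk : (start S - p - 1).val < n - 1 := by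
    have hlt := ZMod.val_lt (start S - p - 1)
    by_contra hge
    have h : (start S - p - 1).val + 1 = n := by omega
    have h' := congrArg (Nat.cast : ℕ → ZMod n) h
    push_cast at h'
    rw [hval, ZMod.natCast_self] at h'
    exact (hstart _).2 ⟨S, hS, rfl⟩ (by linear_combination h')
  have hx : p + 1 + ((start S - p - 1).val : ZMod n) = start S := by rw [hval]; ring
  refine ⟨_, hk, ?_⟩
  have h := (hg _ hk).2.2
  rw [hx] at h ⊢
  exact (heq S hS).trans (intervalA_eq_of_antichain hanti _ (hmem S hS) h)

theorem antichain_intervals_pair_contiguous (n : ℕ) (hn : 0 < n)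
    (G : Finset (Finset (ZMod n)))
    (hint : ∀ S ∈ G, IsInterval n S)
    (hanti : ∀ S ∈ G, ∀ T ∈ G, S ⊆ T → S = T)
    (hcard : G.card = n - 1)
    (htwo : ∃ S ∈ G, ∃ T ∈ G, S.card ≠ T.card) :
    ∃ (j : ℕ), 1 ≤ j ∧ j < n ∧ ∃ (i : ZMod n) (s : ℕ), s ≤ n - 2 ∧
      G = (Finset.range (s + 1)).image (fun t : ℕ => IntervalA n (i + (t : ZMod n)) j) ∪
          (Finset.range (n - s - 2)).image
            (fun t : ℕ => IntervalA n (i + (s : ZMod n) + 1 + (t : ZMod n)) (j + 1)) := by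
  obtain ⟨i, g, hg, hG⟩ := exists_size_function hn hint hanti hcard
  have hmono : ∀ a b, a ≤ b → b < n - 1 → g a ≤ g b := by
    intro a b hab
    induction b, hab using Nat.le_induction with
    | base => exact fun _ => le_rfl
    | succ b _ ih =>
      intro hb
      have h₁ := hg (b + 1) hb
      have h₂ := hg b (by omega)
      have h := size_lt_of_antichain hanti (i + b) one_pos h₁.2.1 h₂.2.1
        (by simpa [add_assoc] using h₁.2.2) h₂.2.2
      have := ih (by omega)
      omega
  obtain ⟨S, hS, T, hT, hST⟩ := htwo
  obtain ⟨a, ha, rfl⟩ := hG S hS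
  obtain ⟨b, hb, rfl⟩ := hG T hT
  rw [card_intervalA _ (hg a ha).2.1, card_intervalA _ (hg b hb).2.1] at hST
  have hlast := hg (n - 2) (by omega)
  have hfirst := hg 0 (by omega)
  have hwrap : g (n - 2) < 2 + g 0 := by
    refine size_lt_of_antichain hanti (i + (n - 2 : ℕ)) two_pos hfirst.2.1 hlast.2.1 ?_ hlast.2.2
    have h : (((n - 2) + 2 : ℕ) : ZMod n) = 0 := by
      rw [show n - 2 + 2 = n by omega, ZMod.natCast_self]
    rw [add_assoc, ← Nat.cast_add, h]
    simpa using hfirst.2.2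
  have ha₁ := hmono 0 a (by omega) ha
  have ha₂ := hmono a (n - 2) (by omega) (by omega)
  have hb₁ := hmono 0 b (by omega) hb
  have hb₂ := hmono b (n - 2) (by omega) (by omega)
  have hex : ∃ k, g k = g 0 + 1 := ⟨n - 2, by omega⟩
  obtain ⟨s, hs⟩ : ∃ s, Nat.find hex = s + 1 := by
    refine Nat.exists_eq_succ_of_ne_zero fun h => ?_
    have := Nat.find_spec hex
    rw [h] at this
    omega
  have hsle : s + 1 ≤ n - 2 := hs ▸ Nat.find_min' hex (by omega)
  have hsval : g (s + 1) = g 0 + 1 := hs ▸ Nat.find_spec hex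
  have hlow : ∀ k ≤ s, g k = g 0 := by
    intro k hk
    have h₁ := Nat.find_min hex (m := k) (by omega)
    have h₂ := hmono 0 k (by omega) (by omega)
    have h₃ := hmono k (n - 2) (by omega) (by omega)
    omega
  have hhigh : ∀ k, s < k → k < n - 1 → g k = g 0 + 1 := by
    intro k hk hkn
    have h₁ := hmono (s + 1) k hk hkn
    have h₂ := hmono k (n - 2) (by omega) (by omega)
    omega
  have hshift : ∀ t : ℕ, i + (s : ZMod n) + 1 + (t : ZMod n) = i + ((s + 1 + t : ℕ) : ZMod n) := by
    intro t
    push_cast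
    ring
  refine ⟨g 0, hfirst.1, by omega, i, s, by omega, ?_⟩
  ext U
  simp only [Finset.mem_union, Finset.mem_image, Finset.mem_range, hshift]
  constructor
  · intro hU
    obtain ⟨k, hk, rfl⟩ := hG U hU
    rcases le_or_gt k s with h | h
    · exact Or.inl ⟨k, by omega, by rw [hlow k h]⟩
    · refine Or.inr ⟨k - (s + 1), by omega, ?_⟩
      rw [hhigh k h hk, show s + 1 + (k - (s + 1)) = k by omega]
  · rintro (⟨t, ht, rfl⟩ | ⟨t, ht, rfl⟩)
    · rw [← hlow t (by omega)]
      exact (hg t (by omega)).2.2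
    · rw [← hhigh (s + 1 + t) (by omega) (by omega)]
      exact (hg _ (by omega)).2.2
end

section
/- Let G be a 2-Sperner family of intervals in Z/nZ, and let I be the number of isolated members of G (members comparable under inclusion with no other member of G). Then |G| ≤ 2n − I. -/
/-- An antichain of intervals in `ZMod n` has at most `n` members: intervals with the same starting
point are comparable. -/
theorem card_le_of_antichain_intervals (n : ℕ) (hn : 0 < n) (F : Finset (Finset (ZMod n)))
    (hint : ∀ S ∈ F, IsInterval n S) (hF : ∀ A ∈ F, ∀ B ∈ F, A ⊆ B → A = B) :
    F.card ≤ n := by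
  have : NeZero n := ⟨hn.ne'⟩
  choose! start len _ _ hS using hint
  have hinj : Set.InjOn start (F : Set (Finset (ZMod n))) := by
    intro A hA B hB hAB
    rcases le_total (len A) (len B) with h | h
    · refine hF A hA B hB ?_
      rw [hS A hA, hS B hB, hAB]
      exact Finset.image_subset_image (Finset.range_subset_range.2 h)
    · refine (hF B hB A hA ?_).symm
      rw [hS A hA, hS B hB, hAB]
      exact Finset.image_subset_image (Finset.range_subset_range.2 h)
  have h := Finset.card_le_card_of_injOn (t := Finset.univ) start (by simp) hinj
  simpa [ZMod.card] using h

/-- A `2`-Sperner family contains no three members `A ⊂ B ⊂ C`. -/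
theorem KSperner.not_ssubset_ssubset {α : Type*} {G : Finset (Finset α)} (hS : KSperner 2 G)
    {A B C : Finset α} (hA : A ∈ G) (hB : B ∈ G) (hC : C ∈ G) (hAB : A ⊂ B) : ¬ B ⊂ C := by
  intro hBC
  refine hS ⟨![A, B, C], ?_, ?_⟩
  · intro i
    fin_cases i <;> simpa
  · rw [Fin.strictMono_iff_lt_succ]
    intro i
    fin_cases i
    · exact hAB
    · exact hBC

theorem twoSperner_intervals_card_le (n : ℕ) (hn : 0 < n)
    (G : Finset (Finset (ZMod n)))
    (hint : ∀ S ∈ G, IsInterval n S)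
    (hS : KSperner 2 G)
    (I : ℕ)
    (hI : I = (G.filter (fun A => ∀ B ∈ G, B ≠ A → ¬ A ⊆ B ∧ ¬ B ⊆ A)).card) :
    G.card ≤ 2 * n - I := by
  classical
  let L := G.filter (fun A => ∀ B ∈ G, B ⊆ A → B = A)
  let U := G.filter (fun A => ∀ B ∈ G, A ⊆ B → A = B)
  have hL : L.card ≤ n := by
    refine card_le_of_antichain_intervals n hn L
      (fun S h => hint S (Finset.mem_filter.1 h).1) ?_
    intro A hA B hB hAB
    exact (Finset.mem_filter.1 hB).2 A (Finset.mem_filter.1 hA).1 hAB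
  have hU : U.card ≤ n := by
    refine card_le_of_antichain_intervals n hn U
      (fun S h => hint S (Finset.mem_filter.1 h).1) ?_
    intro A hA B hB hAB
    exact (Finset.mem_filter.1 hA).2 B (Finset.mem_filter.1 hB).1 hAB
  have hunion : G ⊆ L ∪ U := by
    intro B hB
    by_contra h
    simp only [L, U, Finset.mem_union, Finset.mem_filter, hB, true_and, not_or] at h
    push Not at h
    obtain ⟨⟨A, hA, hAB, hne⟩, C, hC, hBC, hne'⟩ := h
    exact hS.not_ssubset_ssubset hA hB hC (hAB.ssubset_of_ne hne) (hBC.ssubset_of_ne hne')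
  have hinter : I ≤ (L ∩ U).card := by
    rw [hI]
    refine Finset.card_le_card fun A hA => ?_
    obtain ⟨hAG, hA⟩ := Finset.mem_filter.1 hA
    refine Finset.mem_inter.2 ⟨Finset.mem_filter.2 ⟨hAG, fun B hB hBA => ?_⟩,
      Finset.mem_filter.2 ⟨hAG, fun B hB hAB => ?_⟩⟩
    · by_contra hne
      exact (hA B hB hne).2 hBA
    · by_contra hne
      exact (hA B hB (Ne.symm hne)).1 hAB
  have h₁ := Finset.card_le_card hunion
  have h₂ := Finset.card_union_add_card_inter L U
  omega
end

section
/- Let n ≥ 1 and let A ⊊ F ⊊ B be subsets of [n] with 2 ≤ |A| and |B| ≤ n−2. Let α be the number of bijections f : [n] → Z/nZ such that f(A), f(F) and f(B) are all intervals in Z/nZ, and let β be the number of bijections f : [n] → Z/nZ such that f(F) is an interval but neither f(A) nor f(B) is an interval. Then 4β ≥ (|F|·(n−|F|) − 2n + 4)·α. -/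
/-- The bijection `e` maps the finset `A` onto a block of consecutive elements of `Fin p`. -/
def IsBlock {V : Type*} {p : ℕ} (A : Finset V) (e : V ≃ Fin p) : Prop :=
  ∃ s : ℕ, s + A.card ≤ p ∧ ∀ x, x ∈ A ↔ s ≤ (e x : ℕ) ∧ (e x : ℕ) < s + A.card

theorem mul_pred_le_two_mul_choose (a b : ℕ) :
    (a + b + 4) * (a + b + 3) ≤ 2 * (a + b + 4).choose (a + 2) := by
  have two (m : ℕ) : 2 * (m + 4).choose 2 = (m + 4) * (m + 3) := by
    rw [Nat.choose_two_right, Nat.mul_div_cancel']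
    · rfl
    · exact (Nat.even_mul_pred_self (m + 4)).two_dvd
  induction a generalizing b with
  | zero => simpa using (two b).ge
  | succ a iha =>
    induction b with
    | zero =>
      rw [← Nat.choose_symm_of_eq_add (n := a + 1 + 0 + 4) (a := 2) (b := a + 1 + 2) (by omega)]
      simpa using (two (a + 1)).ge
    | succ b ihb =>
      have h1 := iha (b + 1)
      have h2 := Nat.choose_succ_succ (a + b + 5) (a + 2)
      have e1 : a + 1 + (b + 1) + 4 = a + b + 5 + 1 := by ring
      have e2 : a + 1 + b + 4 = a + b + 5 := by ring
      have e3 : a + (b + 1) + 4 = a + b + 5 := by ring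
      rw [e2] at ihb
      rw [e3] at h1
      rw [e1, show a + 1 + 2 = (a + 2).succ from rfl, h2]
      simp only [Nat.succ_eq_add_one] at *
      nlinarith

theorem mul_sub_le_two_mul_choose {p a : ℕ} (ha : 2 ≤ a) (hap : a < p) :
    p * (p - a + 1) ≤ 2 * p.choose a := by
  obtain ⟨a, rfl⟩ := Nat.exists_eq_add_of_le' ha
  obtain ⟨b, rfl⟩ := Nat.exists_eq_add_of_lt hap
  have h1 := mul_pred_le_two_mul_choose a b
  have h2 := Nat.choose_mul_succ_eq (a + 2 + b + 1) (a + 2)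
  have e : a + 2 + b + 1 + 1 = a + b + 4 := by ring
  have e' : a + 2 + b + 1 + 1 - (a + 2) = b + 2 := by omega
  have e'' : a + 2 + b + 1 - (a + 2) + 1 = b + 2 := by omega
  rw [e', e] at h2
  rw [e'']
  have : (a + b + 4) * ((a + 2 + b + 1) * (b + 2)) ≤
      (a + b + 4) * (2 * (a + 2 + b + 1).choose (a + 2)) := by
    calc _ = (a + b + 4) * (a + b + 3) * (b + 2) := by ring
      _ ≤ 2 * (a + b + 4).choose (a + 2) * (b + 2) := Nat.mul_le_mul_right _ h1
      _ = 2 * ((a + b + 4).choose (a + 2) * (b + 2)) := by ring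
      _ = _ := by rw [← h2]; ring
  exact Nat.le_of_mul_le_mul_left this (by omega)

theorem exists_perm_map_eq {W : Type*} [Fintype W] [DecidableEq W] {I J : Finset W}
    (h : I.card = J.card) : ∃ σ : Equiv.Perm W, I.map σ.toEmbedding = J := by
  obtain ⟨τ⟩ : Nonempty ({x // x ∈ I} ≃ {x // x ∈ J}) :=
    ⟨Finset.equivOfCardEq h⟩
  refine ⟨τ.extendSubtype, ?_⟩
  refine Finset.eq_of_subset_of_card_le ?_ (by simp [h])
  intro y hy
  obtain ⟨x, hx, rfl⟩ := Finset.mem_map.1 hy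
  exact Equiv.extendSubtype_mem τ x hx

/-- The number of bijections taking `A` to a given set of the right size. -/
theorem card_map_eq_mul_choose {V : Type*} [Fintype V] [DecidableEq V] {p : ℕ}
    (hV : Fintype.card V = p) (A : Finset V) (I : Finset (Fin p)) (hI : I.card = A.card) :
    (Finset.univ.filter fun e : V ≃ Fin p => A.map e.toEmbedding = I).card * p.choose A.card =
      p.factorial := by
  have total : Fintype.card (V ≃ Fin p) = p.factorial := by
    rw [Fintype.card_equiv (Fintype.equivFinOfCardEq hV), hV]
  have hfib := Finset.card_eq_sum_card_fiberwise (s := Finset.univ)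
    (f := fun e : V ≃ Fin p => A.map e.toEmbedding)
    (t := Finset.powersetCard A.card Finset.univ)
    (by intro e _; simp [Finset.mem_powersetCard])
  rw [← total, ← Finset.card_univ, hfib, Finset.sum_const_nat (m := (Finset.univ.filter
    fun e : V ≃ Fin p => A.map e.toEmbedding = I).card)]
  · rw [Finset.card_powersetCard, Finset.card_univ, Fintype.card_fin, mul_comm]
  intro J hJ
  have hJ' : I.card = J.card := by
    rw [hI, (Finset.mem_powersetCard.1 hJ).2]
  obtain ⟨σ, rfl⟩ := exists_perm_map_eq hJ'
  symm
  refine Finset.card_bij' (fun e _ => e.trans σ) (fun e _ => e.trans σ.symm) ?_ ?_ ?_ ?_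
  · intro e he
    simp only [Finset.mem_filter, Finset.mem_univ, true_and] at he ⊢
    rw [← he, Finset.map_map]
    rfl
  · intro e he
    simp only [Finset.mem_filter, Finset.mem_univ, true_and] at he ⊢
    have : A.map (e.trans σ.symm).toEmbedding = (A.map e.toEmbedding).map σ.symm.toEmbedding := by
      rw [Finset.map_map]
      rfl
    rw [this, he, Finset.map_map]
    ext x
    simp
  · intro e _
    ext x
    simp
  · intro e _
    ext x
    simp

theorem mul_card_isBlock_le {V : Type*} [Fintype V] [DecidableEq V] {p : ℕ}
    (hV : Fintype.card V = p) (A : Finset V) (ha : 2 ≤ A.card) (hap : A.card < p) :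
    p * Nat.card {e : V ≃ Fin p // IsBlock A e} ≤ 2 * p.factorial := by
  classical
  let I : ℕ → Finset (Fin p) := fun s =>
    Finset.univ.filter fun t => s ≤ (t : ℕ) ∧ (t : ℕ) < s + A.card
  let N : ℕ → ℕ := fun s =>
    (Finset.univ.filter fun e : V ≃ Fin p => A.map e.toEmbedding = I s).card
  have hmap (e : V ≃ Fin p) (s : ℕ)
      (h : ∀ x, x ∈ A ↔ s ≤ (e x : ℕ) ∧ (e x : ℕ) < s + A.card) :
      A.map e.toEmbedding = I s := by
    ext t
    obtain ⟨x, rfl⟩ := e.surjective t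
    simp [I, h]
  have hN (s : ℕ) : N s * p.choose A.card ≤ p.factorial := by
    by_cases hc : (I s).card = A.card
    · exact (card_map_eq_mul_choose hV A (I s) hc).le
    · have : N s = 0 := by
        refine Finset.card_eq_zero.2 (Finset.filter_eq_empty_iff.2 ?_)
        intro e _ he
        exact hc (by rw [← he, Finset.card_map])
      simp [this]
  have hcard : Nat.card {e : V ≃ Fin p // IsBlock A e} ≤
      ∑ s ∈ Finset.range (p - A.card + 1), N s := by
    rw [Nat.card_eq_fintype_card, Fintype.card_subtype]
    refine le_trans (Finset.card_le_card ?_) Finset.card_biUnion_le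
    intro e he
    obtain ⟨s, hs, hx⟩ := (Finset.mem_filter.1 he).2
    simp only [Finset.mem_biUnion, Finset.mem_range, Finset.mem_filter, Finset.mem_univ, true_and]
    exact ⟨s, by omega, hmap e s hx⟩
  have hsum : (∑ s ∈ Finset.range (p - A.card + 1), N s) * p.choose A.card ≤
      (p - A.card + 1) * p.factorial := by
    rw [Finset.sum_mul]
    simpa using Finset.sum_le_card_nsmul (Finset.range (p - A.card + 1)) _ _ fun s _ => hN s
  have hchoose := mul_sub_le_two_mul_choose ha hap
  have hpos : 0 < p.choose A.card := Nat.choose_pos hap.le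
  refine Nat.le_of_mul_le_mul_right ?_ hpos
  calc p * Nat.card {e : V ≃ Fin p // IsBlock A e} * p.choose A.card
      ≤ p * ((∑ s ∈ Finset.range (p - A.card + 1), N s) * p.choose A.card) := by
        rw [mul_assoc]
        gcongr
    _ ≤ p * ((p - A.card + 1) * p.factorial) := Nat.mul_le_mul_left _ hsum
    _ = p * (p - A.card + 1) * p.factorial := by ring
    _ ≤ 2 * p.choose A.card * p.factorial := Nat.mul_le_mul_right _ hchoose
    _ = _ := by ring

theorem sub_two_mul_card_isBlock_le {V : Type*} [Fintype V] [DecidableEq V] {p : ℕ}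
    (hV : Fintype.card V = p) (A : Finset V) (ha : 2 ≤ A.card) (hap : A.card < p) :
    ((p : ℤ) - 2) * Nat.card {e : V ≃ Fin p // IsBlock A e} ≤
      2 * Nat.card {e : V ≃ Fin p // ¬ IsBlock A e} := by
  classical
  have h := mul_card_isBlock_le hV A ha hap
  have total : Fintype.card (V ≃ Fin p) = p.factorial := by
    rw [Fintype.card_equiv (Fintype.equivFinOfCardEq hV), hV]
  have hsplit : Nat.card {e : V ≃ Fin p // IsBlock A e} +
      Nat.card {e : V ≃ Fin p // ¬ IsBlock A e} = p.factorial := by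
    rw [← total, Nat.card_eq_fintype_card, Nat.card_eq_fintype_card, ← Fintype.card_sum]
    exact Fintype.card_congr (Equiv.sumCompl _)
  rw [← hsplit] at h
  zify at h
  linarith

theorem card_zmod_prod_prod (n : ℕ) (X Y : Type*) :
    Nat.card (ZMod n × X × Y) = n * (Nat.card X * Nat.card Y) := by
  rw [Nat.card_prod, Nat.card_prod, Nat.card_zmod]

theorem mem_interval_iff {n : ℕ} [NeZero n] (k : ZMod n) {j : ℕ} (hj : j ≤ n) (x : ZMod n) :
    x ∈ (Finset.range j).image (fun t : ℕ => k + (t : ZMod n)) ↔ (x - k).val < j := by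
  simp only [Finset.mem_image, Finset.mem_range]
  constructor
  · rintro ⟨t, ht, rfl⟩
    rwa [add_sub_cancel_left, ZMod.val_natCast_of_lt (by omega)]
  · intro h
    exact ⟨(x - k).val, h, by simp⟩

theorem card_interval {n : ℕ} [NeZero n] (k : ZMod n) {j : ℕ} (hj : j ≤ n) :
    ((Finset.range j).image (fun t : ℕ => k + (t : ZMod n))).card = j := by
  rw [Finset.card_image_of_injOn, Finset.card_range]
  intro t ht u hu h
  simp only [Finset.coe_range, Set.mem_Iio] at ht hu
  have := congrArg ZMod.val (add_left_cancel h)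
  rwa [ZMod.val_natCast_of_lt (by omega), ZMod.val_natCast_of_lt (by omega)] at this

theorem IsInterval.exists_forall_mem_iff {n : ℕ} [NeZero n] {S : Finset (ZMod n)}
    (h : IsInterval n S) : ∃ k : ZMod n, ∀ x, x ∈ S ↔ (x - k).val < S.card := by
  obtain ⟨k, j, _, hj, rfl⟩ := h
  refine ⟨k, fun x => ?_⟩
  rw [card_interval k hj, mem_interval_iff k hj]

theorem isInterval_of_forall_mem_iff {n : ℕ} [NeZero n] {S : Finset (ZMod n)} {k : ZMod n} {j : ℕ}
    (hj : 0 < j) (hjn : j ≤ n) (h : ∀ x, x ∈ S ↔ (x - k).val < j) : IsInterval n S :=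
  ⟨k, j, hj, hjn, by ext x; rw [h, mem_interval_iff k hjn]⟩

theorem val_sub_natCast {n : ℕ} [NeZero n] (y : ZMod n) {m : ℕ} (hm : m < n) :
    (y - (m : ZMod n)).val = if m ≤ y.val then y.val - m else y.val + n - m := by
  have hy := y.val_lt
  split_ifs with h
  · rw [ZMod.val_sub (by rwa [ZMod.val_natCast_of_lt hm]), ZMod.val_natCast_of_lt hm]
  · have : y - (m : ZMod n) = ((y.val + n - m : ℕ) : ZMod n) := by
      rw [Nat.cast_sub (by omega)]
      simp
    rw [this, ZMod.val_natCast_of_lt (by omega)]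

theorem IsInterval.compl {n : ℕ} [NeZero n] {S : Finset (ZMod n)}
    (h : IsInterval n S) (hS : S.card < n) : IsInterval n Sᶜ := by
  obtain ⟨k, hk⟩ := h.exists_forall_mem_iff
  refine isInterval_of_forall_mem_iff (k := k + (S.card : ZMod n)) (j := n - S.card)
    (by omega) (by omega) fun x => ?_
  have hx := (x - k).val_lt
  rw [Finset.mem_compl, hk, ← sub_sub, val_sub_natCast _ hS]
  split_ifs <;> omega

/-- An interval contained in a proper arc does not wrap around relative to that arc. -/
theorem IsInterval.exists_block {n : ℕ} [NeZero n] {S : Finset (ZMod n)} (h : IsInterval n S)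
    (hS : 0 < S.card) {i : ZMod n} {p : ℕ} (hp : p < n) (hSp : ∀ x ∈ S, (x - i).val < p) :
    ∃ s : ℕ, s + S.card ≤ p ∧
      ∀ x, x ∈ S ↔ s ≤ (x - i).val ∧ (x - i).val < s + S.card := by
  obtain ⟨k, hk⟩ := h.exists_forall_mem_iff
  set s := (k - i).val with hs
  have hsn : s < n := (k - i).val_lt
  have hmem (x : ZMod n) : x ∈ S ↔
      (if s ≤ (x - i).val then (x - i).val - s else (x - i).val + n - s) < S.card := by
    rw [hk, ← val_sub_natCast _ hsn]
    simp [hs]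
  have hval (m : ℕ) (hm : m < n) : (i + (m : ZMod n) - i).val = m := by
    rw [add_sub_cancel_left, ZMod.val_natCast_of_lt hm]
  have hcard : S.card ≤ n := by simpa using Finset.card_le_univ S
  have hle : s + S.card ≤ n := by
    by_contra hlt
    have hmem' := (hmem (i + ((n - 1 : ℕ) : ZMod n))).2 (by
      rw [hval _ (by omega), if_pos (by omega)]
      omega)
    have := hSp _ hmem'
    rw [hval _ (by omega)] at this
    omega
  refine ⟨s, ?_, fun x => ?_⟩
  · have hmem' := (hmem (i + ((s + S.card - 1 : ℕ) : ZMod n))).2 (by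
      rw [hval _ (by omega), if_pos (by omega)]
      omega)
    have := hSp _ hmem'
    rw [hval _ (by omega)] at this
    omega
  · rw [hmem]
    have := (x - i).val_lt
    split_ifs <;> omega

theorem eq_of_forall_val_sub_lt_iff {n : ℕ} [NeZero n] {i k : ZMod n} {p : ℕ} (hp : 0 < p)
    (hpn : p < n) (h : ∀ x : ZMod n, (x - i).val < p ↔ (x - k).val < p) : i = k := by
  set d := (k - i).val with hd
  have hdn : d < n := (k - i).val_lt
  have hx (x : ZMod n) : (x - k).val =
      if d ≤ (x - i).val then (x - i).val - d else (x - i).val + n - d := by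
    rw [← val_sub_natCast _ hdn]
    simp [hd]
  have hval (m : ℕ) (hm : m < n) : (i + (m : ZMod n) - i).val = m := by
    rw [add_sub_cancel_left, ZMod.val_natCast_of_lt hm]
  rcases Nat.eq_zero_or_pos d with h0 | h0
  · have := (ZMod.val_eq_zero _).1 (hd.symm.trans h0)
    exact (sub_eq_zero.1 this).symm
  · exfalso
    have h1 := h (i + ((d + p - 1 : ℕ) : ZMod n))
    have h2 := h (i + ((d - 1 : ℕ) : ZMod n))
    have h3 := h (i + ((p - 1 : ℕ) : ZMod n))
    have h4 := h i
    have h5 := h k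
    rw [hx, hval _ (by omega)] at h2 h3
    rw [hx, sub_self, ZMod.val_zero] at h4
    rw [sub_self, ZMod.val_zero, ← hd] at h5
    by_cases hlt : d + p - 1 < n
    · rw [hx, hval _ hlt] at h1
      split_ifs at * <;> omega
    · split_ifs at * <;> omega

section Assemble

variable {n : ℕ} {F : Finset (Fin n)} {p q : ℕ}

/-- The position, relative to the start of the arc carrying `F`, in the cyclic arrangement that
lists `F` in the order given by `e₁` and then its complement in the order given by `e₂`. -/
def arcPosition (e₁ : {x // x ∈ F} ≃ Fin p) (e₂ : {x // x ∉ F} ≃ Fin q) (x : Fin n) : ℕ :=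
  if h : x ∈ F then (e₁ ⟨x, h⟩ : ℕ) else p + (e₂ ⟨x, h⟩ : ℕ)

theorem arcPosition_lt (hpq : p + q = n) (e₁ : {x // x ∈ F} ≃ Fin p)
    (e₂ : {x // x ∉ F} ≃ Fin q) (x : Fin n) : arcPosition e₁ e₂ x < n := by
  unfold arcPosition
  split_ifs with h
  · have := (e₁ ⟨x, h⟩).isLt
    omega
  · have := (e₂ ⟨x, h⟩).isLt
    omega

theorem arcPosition_lt_iff (e₁ : {x // x ∈ F} ≃ Fin p) (e₂ : {x // x ∉ F} ≃ Fin q) (x : Fin n) :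
    arcPosition e₁ e₂ x < p ↔ x ∈ F := by
  unfold arcPosition
  split_ifs with h
  · simp [h]
  · simp [h]

theorem arcPosition_injective (e₁ : {x // x ∈ F} ≃ Fin p) (e₂ : {x // x ∉ F} ≃ Fin q) :
    Function.Injective (arcPosition e₁ e₂) := by
  intro x y hxy
  have h1 := arcPosition_lt_iff e₁ e₂ x
  have h2 := arcPosition_lt_iff e₁ e₂ y
  rw [hxy, h2] at h1
  unfold arcPosition at hxy
  by_cases hx : x ∈ F
  · rw [dif_pos hx, dif_pos (h1.2 hx)] at hxy
    simpa using e₁.injective (Fin.ext hxy)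
  · rw [dif_neg hx, dif_neg (fun h => hx (h1.1 h))] at hxy
    simpa using e₂.injective (Fin.ext (Nat.add_left_cancel hxy))

variable [NeZero n]

/-- The cyclic arrangement placing `F` on the arc of length `p` starting at `i`, ordered by `e₁`,
followed by the complement of `F`, ordered by `e₂`. -/
noncomputable def arcArrangement (hpq : p + q = n) (i : ZMod n) (e₁ : {x // x ∈ F} ≃ Fin p)
    (e₂ : {x // x ∉ F} ≃ Fin q) : Fin n ≃ ZMod n :=
  Equiv.ofBijective (fun x => i + (arcPosition e₁ e₂ x : ZMod n)) <| by
    rw [Fintype.bijective_iff_injective_and_card]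
    refine ⟨fun x y hxy => arcPosition_injective e₁ e₂ ?_, by simp [ZMod.card]⟩
    have := congrArg ZMod.val (add_left_cancel hxy)
    rwa [ZMod.val_natCast_of_lt (arcPosition_lt hpq _ _ _),
      ZMod.val_natCast_of_lt (arcPosition_lt hpq _ _ _)] at this

theorem val_arcArrangement_sub (hpq : p + q = n) (i : ZMod n) (e₁ : {x // x ∈ F} ≃ Fin p)
    (e₂ : {x // x ∉ F} ≃ Fin q) (x : Fin n) :
    (arcArrangement hpq i e₁ e₂ x - i).val = arcPosition e₁ e₂ x := by
  simp only [arcArrangement, Equiv.ofBijective_apply, add_sub_cancel_left]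
  exact ZMod.val_natCast_of_lt (arcPosition_lt hpq _ _ _)

theorem val_arcArrangement_sub_of_mem (hpq : p + q = n) (i : ZMod n) (e₁ : {x // x ∈ F} ≃ Fin p)
    (e₂ : {x // x ∉ F} ≃ Fin q) (x : {x // x ∈ F}) :
    (arcArrangement hpq i e₁ e₂ x - i).val = e₁ x := by
  rw [val_arcArrangement_sub, arcPosition, dif_pos x.2]

theorem val_arcArrangement_sub_of_notMem (hpq : p + q = n) (hp : p < n) (i : ZMod n)
    (e₁ : {x // x ∈ F} ≃ Fin p) (e₂ : {x // x ∉ F} ≃ Fin q) (x : {x // x ∉ F}) :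
    (arcArrangement hpq i e₁ e₂ x - (i + (p : ZMod n))).val = e₂ x := by
  rw [← sub_sub, val_sub_natCast _ hp, val_arcArrangement_sub, arcPosition, dif_neg x.2]
  simp

theorem mem_image_arcArrangement_iff (hpq : p + q = n) (i : ZMod n) (e₁ : {x // x ∈ F} ≃ Fin p)
    (e₂ : {x // x ∉ F} ≃ Fin q) (y : ZMod n) :
    y ∈ F.image (arcArrangement hpq i e₁ e₂) ↔ (y - i).val < p := by
  obtain ⟨x, rfl⟩ := (arcArrangement hpq i e₁ e₂).surjective y
  rw [val_arcArrangement_sub, arcPosition_lt_iff]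
  simp

theorem isInterval_image_arcArrangement (hpq : p + q = n) (hp : 0 < p) (i : ZMod n)
    (e₁ : {x // x ∈ F} ≃ Fin p) (e₂ : {x // x ∉ F} ≃ Fin q) :
    IsInterval n (F.image (arcArrangement hpq i e₁ e₂)) :=
  isInterval_of_forall_mem_iff hp (by omega) (mem_image_arcArrangement_iff hpq i e₁ e₂)

theorem arcArrangement_injective (hpq : p + q = n) (hp : 0 < p) (hq : 0 < q)
    {i i' : ZMod n} {e₁ e₁' : {x // x ∈ F} ≃ Fin p} {e₂ e₂' : {x // x ∉ F} ≃ Fin q}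
    (h : arcArrangement hpq i e₁ e₂ = arcArrangement hpq i' e₁' e₂') :
    i = i' ∧ e₁ = e₁' ∧ e₂ = e₂' := by
  have hi : i = i' := eq_of_forall_val_sub_lt_iff hp (by omega) fun y => by
    rw [← mem_image_arcArrangement_iff hpq i e₁ e₂, h, mem_image_arcArrangement_iff]
  subst hi
  refine ⟨rfl, ?_, ?_⟩
  · ext x
    rw [← val_arcArrangement_sub_of_mem hpq i e₁ e₂, h, val_arcArrangement_sub_of_mem]
  · ext x
    rw [← val_arcArrangement_sub_of_notMem hpq (by omega) i e₁ e₂, h,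
      val_arcArrangement_sub_of_notMem hpq (by omega)]

theorem exists_arcArrangement_eq (hpq : p + q = n) (hF : F.card = p) (hq : 0 < q)
    {f : Fin n ≃ ZMod n} (hf : IsInterval n (F.image f)) :
    ∃ (i : ZMod n) (e₁ : {x // x ∈ F} ≃ Fin p) (e₂ : {x // x ∉ F} ≃ Fin q),
      arcArrangement hpq i e₁ e₂ = f := by
  obtain ⟨i, hi⟩ := hf.exists_forall_mem_iff
  have hpn : p < n := by omega
  have hmem (x : Fin n) : x ∈ F ↔ (f x - i).val < p := by
    rw [← hF, ← Finset.card_image_of_injective F f.injective, ← hi]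
    simp
  have hinj (k : ZMod n) {x y : Fin n} (h : (f x - k).val = (f y - k).val) : x = y :=
    f.injective (sub_left_injective (ZMod.val_injective n h))
  have hlt (x : Fin n) (hx : x ∉ F) : (f x - (i + (p : ZMod n))).val = (f x - i).val - p := by
    rw [hmem] at hx
    rw [← sub_sub, val_sub_natCast _ hpn, if_pos (by omega)]
  let g₁ : {x // x ∈ F} → Fin p := fun x => ⟨(f x - i).val, (hmem x).1 x.2⟩
  let g₂ : {x // x ∉ F} → Fin q := fun x => ⟨(f x - (i + (p : ZMod n))).val, by
    have := (f x - i).val_lt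
    rw [hlt x x.2]
    omega⟩
  have hg₁ : Function.Bijective g₁ := by
    rw [Fintype.bijective_iff_injective_and_card]
    refine ⟨fun x y h => Subtype.ext (hinj i (congrArg Fin.val h)), by simp [hF]⟩
  have hg₂ : Function.Bijective g₂ := by
    rw [Fintype.bijective_iff_injective_and_card]
    refine ⟨fun x y h => Subtype.ext (hinj (i + (p : ZMod n)) (congrArg Fin.val h)), ?_⟩
    rw [Fintype.card_subtype_compl]
    simp [hF]
    omega
  refine ⟨i, Equiv.ofBijective g₁ hg₁, Equiv.ofBijective g₂ hg₂, ?_⟩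
  ext x
  have hpos : arcPosition (Equiv.ofBijective g₁ hg₁) (Equiv.ofBijective g₂ hg₂) x =
      (f x - i).val := by
    unfold arcPosition
    split_ifs with hx
    · rfl
    · have h1 := hlt x hx
      rw [hmem] at hx
      simp only [Equiv.ofBijective_apply, g₂]
      omega
  simp [arcArrangement, hpos]

theorem isBlock_of_isInterval_image {A : Finset (Fin n)} (hpq : p + q = n) (hq : 0 < q)
    (hA : 0 < A.card) (hAF : A ⊆ F) {i : ZMod n} {e₁ : {x // x ∈ F} ≃ Fin p}
    {e₂ : {x // x ∉ F} ≃ Fin q} (h : IsInterval n (A.image (arcArrangement hpq i e₁ e₂))) :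
    IsBlock (A.subtype (· ∈ F)) e₁ := by
  set f := arcArrangement hpq i e₁ e₂ with hf
  have hcard : (A.image f).card = A.card := Finset.card_image_of_injective A f.injective
  have hcard' : (A.subtype (· ∈ F)).card = A.card := by
    rw [Finset.card_subtype, Finset.filter_true_of_mem fun x hx => hAF hx]
  obtain ⟨s, hs, hx⟩ := h.exists_block (by omega) (i := i) (p := p) (by omega) (by
    intro y hy
    rw [← mem_image_arcArrangement_iff hpq i e₁ e₂]
    exact Finset.image_subset_image hAF hy)
  rw [hcard] at hs hx
  refine ⟨s, by omega, fun x => ?_⟩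
  rw [hcard', ← val_arcArrangement_sub_of_mem hpq i e₁ e₂, ← hf, ← hx]
  simp

theorem isBlock_of_isInterval_image_compl {B : Finset (Fin n)} (hpq : p + q = n) (hp : 0 < p)
    (hB : B.card < n) (hFB : F ⊆ B) {i : ZMod n} {e₁ : {x // x ∈ F} ≃ Fin p}
    {e₂ : {x // x ∉ F} ≃ Fin q} (hq : 0 < q)
    (h : IsInterval n (B.image (arcArrangement hpq i e₁ e₂))) :
    IsBlock (Bᶜ.subtype (· ∉ F)) e₂ := by
  set f := arcArrangement hpq i e₁ e₂ with hf
  have hcardB : (B.image f).card = B.card := Finset.card_image_of_injective B f.injective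
  have hcompl : (B.image f)ᶜ = Bᶜ.image f := by
    ext y
    obtain ⟨x, rfl⟩ := f.surjective y
    simp
  have hB' : Bᶜ.card = n - B.card := by simp [Finset.card_compl]
  have hcard : (Bᶜ.image f).card = Bᶜ.card := Finset.card_image_of_injective _ f.injective
  have hnot (x : Fin n) (hx : x ∈ Bᶜ) : x ∉ F := fun hxF => Finset.mem_compl.1 hx (hFB hxF)
  have hcard' : (Bᶜ.subtype (· ∉ F)).card = Bᶜ.card := by
    rw [Finset.card_subtype, Finset.filter_true_of_mem hnot]
  have h' := h.compl (by omega)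
  rw [hcompl] at h'
  obtain ⟨s, hs, hx⟩ := h'.exists_block (by omega) (i := i + (p : ZMod n)) (p := q) (by omega) (by
    intro y hy
    obtain ⟨x, hxB, rfl⟩ := Finset.mem_image.1 hy
    have := val_arcArrangement_sub_of_notMem hpq (by omega) i e₁ e₂ ⟨x, hnot x hxB⟩
    rw [← hf] at this
    rw [this]
    exact Fin.isLt _)
  rw [hcard] at hs hx
  refine ⟨s, by omega, fun x => ?_⟩
  rw [hcard', ← val_arcArrangement_sub_of_notMem hpq (by omega) i e₁ e₂, ← hf, ← hx]
  simp

end Assemble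

theorem beta_alpha_estimate (n : ℕ) (hn : 0 < n)
    (A F B : Finset (Fin n)) (hAF : A ⊂ F) (hFB : F ⊂ B)
    (hA : 2 ≤ A.card) (hB : B.card ≤ n - 2)
    (α β : ℕ)
    (hα : α = Nat.card {f : Fin n ≃ ZMod n //
      IsInterval n (A.image f) ∧ IsInterval n (F.image f) ∧ IsInterval n (B.image f)})
    (hβ : β = Nat.card {f : Fin n ≃ ZMod n //
      IsInterval n (F.image f) ∧ ¬ IsInterval n (A.image f) ∧ ¬ IsInterval n (B.image f)}) :
    ((F.card : ℤ) * ((n : ℤ) - F.card) - 2 * n + 4) * α ≤ 4 * β := by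
  have : NeZero n := ⟨hn.ne'⟩
  have hAF' := Finset.card_lt_card hAF
  have hFB' := Finset.card_lt_card hFB
  set p := F.card with hp
  obtain ⟨q, hpq⟩ : ∃ q, p + q = n := ⟨n - p, by omega⟩
  have hp0 : 0 < p := by omega
  have hq0 : 0 < q := by omega
  have hV : Fintype.card {x // x ∈ F} = p := by simp [hp]
  have hW : Fintype.card {x // x ∉ F} = q := by
    rw [Fintype.card_subtype_compl]
    simp only [Fintype.card_fin, Fintype.card_coe]
    omega
  have hcardA : (A.subtype (· ∈ F)).card = A.card := by
    rw [Finset.card_subtype, Finset.filter_true_of_mem fun x hx => hAF.1 hx]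
  have hcardB : (Bᶜ.subtype (· ∉ F)).card = n - B.card := by
    have hnot (x : Fin n) (hx : x ∈ Bᶜ) : x ∉ F := fun hxF => Finset.mem_compl.1 hx (hFB.1 hxF)
    rw [Finset.card_subtype, Finset.filter_true_of_mem hnot, Finset.card_compl, Fintype.card_fin]
  have h₁ := sub_two_mul_card_isBlock_le hV (A.subtype (· ∈ F)) (by omega) (by omega)
  have h₂ := sub_two_mul_card_isBlock_le hW (Bᶜ.subtype (· ∉ F)) (by omega) (by omega)
  have hα' : α ≤ n * (Nat.card {e : {x // x ∈ F} ≃ Fin p // IsBlock (A.subtype (· ∈ F)) e} *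
      Nat.card {e : {x // x ∉ F} ≃ Fin q // IsBlock (Bᶜ.subtype (· ∉ F)) e}) := by
    rw [hα, ← card_zmod_prod_prod]
    have key (f : {f : Fin n ≃ ZMod n //
        IsInterval n (A.image f) ∧ IsInterval n (F.image f) ∧ IsInterval n (B.image f)}) :
        ∃ t : ZMod n × {e : {x // x ∈ F} ≃ Fin p // IsBlock (A.subtype (· ∈ F)) e} ×
          {e : {x // x ∉ F} ≃ Fin q // IsBlock (Bᶜ.subtype (· ∉ F)) e},
          arcArrangement hpq t.1 t.2.1.1 t.2.2.1 = f.1 := by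
      obtain ⟨f, hfA, hfF, hfB⟩ := f
      obtain ⟨i, e₁, e₂, rfl⟩ := exists_arcArrangement_eq hpq hp.symm hq0 hfF
      exact ⟨⟨i, ⟨e₁, isBlock_of_isInterval_image hpq hq0 (by omega) hAF.1 hfA⟩,
        ⟨e₂, isBlock_of_isInterval_image_compl hpq hp0 (by omega) hFB.1 hq0 hfB⟩⟩, rfl⟩
    choose g hg using key
    refine Nat.card_le_card_of_injective g fun f f' h => Subtype.ext ?_
    rw [← hg f, ← hg f', h]
  have hβ' : n * (Nat.card {e : {x // x ∈ F} ≃ Fin p // ¬ IsBlock (A.subtype (· ∈ F)) e} *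
      Nat.card {e : {x // x ∉ F} ≃ Fin q // ¬ IsBlock (Bᶜ.subtype (· ∉ F)) e}) ≤ β := by
    rw [hβ, ← card_zmod_prod_prod]
    refine Nat.card_le_card_of_injective (fun t => ⟨arcArrangement hpq t.1 t.2.1.1 t.2.2.1,
      isInterval_image_arcArrangement hpq hp0 _ _ _,
      fun h => t.2.1.2 (isBlock_of_isInterval_image hpq hq0 (by omega) hAF.1 h),
      fun h => t.2.2.2
        (isBlock_of_isInterval_image_compl hpq hp0 (by omega) hFB.1 hq0 h)⟩) ?_
    rintro ⟨i, ⟨e₁, _⟩, ⟨e₂, _⟩⟩ ⟨i', ⟨e₁', _⟩, ⟨e₂', _⟩⟩ h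
    obtain ⟨rfl, rfl, rfl⟩ := arcArrangement_injective hpq hp0 hq0 (congrArg Subtype.val h)
    rfl
  generalize Nat.card {e : {x // x ∈ F} ≃ Fin p // IsBlock (A.subtype (· ∈ F)) e} = a at *
  generalize Nat.card {e : {x // x ∉ F} ≃ Fin q // IsBlock (Bᶜ.subtype (· ∉ F)) e} = b at *
  generalize Nat.card {e : {x // x ∈ F} ≃ Fin p // ¬ IsBlock (A.subtype (· ∈ F)) e} = c at *
  generalize Nat.card {e : {x // x ∉ F} ≃ Fin q // ¬ IsBlock (Bᶜ.subtype (· ∉ F)) e} = d at *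
  have hp2 : (0 : ℤ) ≤ (p : ℤ) - 2 := by omega
  have hq2 : (0 : ℤ) ≤ (q : ℤ) - 2 := by omega
  have hn' : (n : ℤ) = p + q := by omega
  zify at hα' hβ'
  calc ((p : ℤ) * (n - p) - 2 * n + 4) * α = ((p - 2) * (q - 2)) * α := by rw [hn']; ring
    _ ≤ ((p - 2) * (q - 2)) * (n * (a * b)) :=
      mul_le_mul_of_nonneg_left hα' (mul_nonneg hp2 hq2)
    _ = n * (((p - 2) * a) * ((q - 2) * b)) := by ring
    _ ≤ n * ((2 * c) * (2 * d)) := by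
      gcongr
    _ = 4 * (n * (c * d)) := by ring
    _ ≤ 4 * β := by linarith
end

section
/- Let n ≥ 18 and let F be a butterfly-free family of subsets of [n] that contains a set of size 1 or a set of size n−1. Then |F| < Σ_I(n,2). -/
open Finset Nat Numbering in
/-- The number of numberings having both members of `B ⊆ C` as prefixes. -/
lemma card_prefixed_inter_prefixed {X : Type*} [Fintype X] [DecidableEq X]
    {B C : Finset X} (hBC : B ⊆ C) :
    #(prefixed B ∩ prefixed C) = (#B)! * (#C - #B)! * (Fintype.card X - #C)! := by
  have key : ∀ f : prefixed C, f.1 ∈ prefixed B ↔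
      (prefixedEquiv C f).1 ∈ prefixed (B.subtype (· ∈ C)) := by
    intro f
    have hcard : #(B.subtype (· ∈ C)) = #B := by
      rw [card_subtype, filter_true_of_mem fun x hx => hBC hx]
    have hf := mem_prefixed.1 f.2
    simp only [mem_prefixed, IsPrefix, hcard, mem_subtype]
    constructor
    · intro h x
      simpa [prefixedEquiv] using h x
    · intro h x
      by_cases hx : x ∈ C
      · simpa [prefixedEquiv] using h ⟨x, hx⟩
      · have h1 := (hf x).not.1 hx
        have h2 := card_le_card hBC
        exact ⟨fun hxB => absurd (hBC hxB) hx, fun h3 => by omega⟩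
  have e1 : {f : prefixed C // f.1 ∈ prefixed B} ≃
      {p : Numbering C × Numbering ↑(Cᶜ) // p.1 ∈ prefixed (B.subtype (· ∈ C))} :=
    (prefixedEquiv C).subtypeEquiv key
  have e2 : {p : Numbering C × Numbering ↑(Cᶜ) // p.1 ∈ prefixed (B.subtype (· ∈ C))} ≃
      prefixed (B.subtype (· ∈ C)) × Numbering ↑(Cᶜ) :=
    { toFun := fun p => (⟨p.1.1, p.2⟩, p.1.2)
      invFun := fun q => ⟨(q.1.1, q.2), q.1.2⟩
      left_inv := fun _ => rfl
      right_inv := fun _ => rfl }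
  have e3 : {f : prefixed C // f.1 ∈ prefixed B} ≃ ↥(prefixed B ∩ prefixed C) :=
    { toFun := fun f => ⟨f.1.1, mem_inter.2 ⟨f.2, f.1.2⟩⟩
      invFun := fun f => ⟨⟨f.1, (mem_inter.1 f.2).2⟩, (mem_inter.1 f.2).1⟩
      left_inv := fun _ => rfl
      right_inv := fun _ => rfl }
  have h := Fintype.card_congr (e3.symm.trans (e1.trans e2))
  rw [Fintype.card_coe, Fintype.card_prod, Fintype.card_coe, card_prefixed,
    Fintype.card_numbering] at h
  rw [h, card_subtype, filter_true_of_mem fun x hx => hBC hx]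
  simp

open Nat in
lemma factorial_mul_factorial_mul_add_le {i j : ℕ} (hi : 1 ≤ i) (hj : 1 ≤ j) :
    i ! * j ! * (i + j) ≤ (i + j)! := by
  obtain ⟨j, rfl⟩ := Nat.exists_eq_add_of_le' hj
  have h : i ! * (j + 1)! ≤ (i + j)! := by
    clear hj
    induction j with
    | zero => simp
    | succ j ih =>
      calc i ! * (j + 1 + 1)! = (j + 2) * (i ! * (j + 1)!) := by
            rw [factorial_succ (j + 1)]; ring
        _ ≤ (i + j + 1) * (i + j)! := Nat.mul_le_mul (by omega) ih
        _ = (i + (j + 1))! := by rw [← add_assoc, factorial_succ]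
  calc i ! * (j + 1)! * (i + (j + 1)) ≤ (i + j)! * (i + (j + 1)) := Nat.mul_le_mul_right _ h
    _ = (i + (j + 1))! := by rw [← add_assoc, factorial_succ]; ring

open Finset Nat Numbering in
lemma card_prefixed_inter_upper {X : Type*} [Fintype X] [DecidableEq X]
    {B C : Finset X} (hBC : B ⊂ C) (hC : C ≠ univ) :
    #(prefixed B ∩ prefixed C) * (Fintype.card X - #B) ≤ #(prefixed B) := by
  rw [card_prefixed_inter_prefixed hBC.subset, card_prefixed]
  have h1 := card_lt_card hBC
  have h2 : #C < Fintype.card X := card_lt_iff_ne_univ C |>.2 hC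
  have h := factorial_mul_factorial_mul_add_le (i := #C - #B) (j := Fintype.card X - #C)
    (by omega) (by omega)
  rw [show #C - #B + (Fintype.card X - #C) = Fintype.card X - #B by omega] at h
  calc _ = (#B)! * ((#C - #B)! * (Fintype.card X - #C)! * (Fintype.card X - #B)) := by ring
    _ ≤ _ := Nat.mul_le_mul_left _ h

open Finset Nat Numbering in
lemma card_prefixed_inter_lower {X : Type*} [Fintype X] [DecidableEq X]
    {A B : Finset X} (hAB : A ⊂ B) (hA : A ≠ ∅) :
    2 * #(prefixed A ∩ prefixed B) ≤ #(prefixed B) := by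
  rw [card_prefixed_inter_prefixed hAB.subset, card_prefixed]
  have h1 := card_lt_card hAB
  have h2 : 0 < #A := card_pos.2 (nonempty_iff_ne_empty.2 hA)
  have h := factorial_mul_factorial_mul_add_le (i := #A) (j := #B - #A) h2 (by omega)
  rw [show #A + (#B - #A) = #B by omega] at h
  calc _ = (#A)! * (#B - #A)! * 2 * (Fintype.card X - #B)! := by ring
    _ ≤ (#A)! * (#B - #A)! * #B * (Fintype.card X - #B)! := by gcongr; omega
    _ ≤ _ := Nat.mul_le_mul_right _ h

open Finset Nat Numbering in
lemma card_prefixed_mul_choose {X : Type*} [Fintype X] [DecidableEq X] (A : Finset X) :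
    #(prefixed A) * (Fintype.card X).choose #A = (Fintype.card X)! := by
  rw [card_prefixed, ← choose_mul_factorial_mul_factorial (card_le_univ A)]
  ring

open Finset Nat Numbering in
lemma factorial_le_card_prefixed_mul {X : Type*} [Fintype X] [DecidableEq X] (A : Finset X) :
    (Fintype.card X)! ≤ #(prefixed A) * (Fintype.card X).choose (Fintype.card X / 2) := by
  rw [← card_prefixed_mul_choose A]
  exact Nat.mul_le_mul_left _ (choose_le_middle _ _)

open Finset Numbering in
lemma ssubset_or_ssubset_of_mem_prefixed {X : Type*} [Fintype X] [DecidableEq X]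
    {f : Numbering X} {A B : Finset X} (hA : f ∈ prefixed A) (hB : f ∈ prefixed B)
    (hne : A ≠ B) : A ⊂ B ∨ B ⊂ A := by
  by_contra h
  push Not at h
  refine disjoint_left.1 (disjoint_prefixed_prefixed ?_ ?_) hA hB
  · exact fun hs => h.1 (hs.ssubset_of_ne hne)
  · exact fun hs => h.2 (hs.ssubset_of_ne hne.symm)

open Finset Nat Numbering in
/-- If every member of `G` has at most one strict superset in `G` and the whole set is not in `G`,
then `G` is only slightly larger than the middle level. -/
lemma four_mul_card_le_of_forkFree {X : Type*} [Fintype X] [DecidableEq X]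
    (hX : 17 ≤ Fintype.card X) (G : Finset (Finset X)) (huniv : univ ∉ G)
    (hG : ∀ B ∈ G, ∀ C ∈ G, ∀ D ∈ G, B ⊂ C → B ⊂ D → C = D) :
    4 * #G ≤ 5 * (Fintype.card X).choose (Fintype.card X / 2) := by
  set N := Fintype.card X with hN
  have hi : ∀ B : Finset X, ∃ Q : Finset (Numbering X),
      (B ∈ G → (Q ⊆ prefixed B ∧ (∀ C ∈ G, B ⊂ C → Disjoint Q (prefixed C)) ∧
        4 * N ! ≤ 5 * N.choose (N / 2) * #Q)) := by
    intro B
    by_cases hL : B ∈ G ∧ ∃ C ∈ G, B ⊂ C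
    · obtain ⟨hB, C, hC, hBC⟩ := hL
      refine ⟨prefixed B \ prefixed C, fun _ => ⟨sdiff_subset, ?_, ?_⟩⟩
      · intro D hD hBD
        rw [← hG B hB C hC D hD hBC hBD]
        exact sdiff_disjoint
      have hCu : C ≠ univ := fun h => huniv (h ▸ hC)
      have h1 := card_prefixed_inter_upper hBC hCu
      have h2 := card_sdiff_add_card_inter (prefixed B) (prefixed C)
      have h3 := card_lt_card hBC
      have h4 : #C < N := (card_lt_iff_ne_univ C).2 hCu
      set q := #(prefixed B \ prefixed C)
      set p := #(prefixed B ∩ prefixed C)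
      by_cases hk : 5 ≤ N - #B
      · have h5 : p * 5 ≤ #(prefixed B) := (Nat.mul_le_mul_left _ hk).trans h1
        have h6 := factorial_le_card_prefixed_mul B
        rw [← hN] at h6
        calc 4 * N ! ≤ 4 * #(prefixed B) * N.choose (N / 2) := by
              rw [mul_assoc]; exact Nat.mul_le_mul_left _ h6
          _ ≤ (5 * q) * N.choose (N / 2) := Nat.mul_le_mul_right _ (by omega)
          _ = _ := by ring
      · have h5 : p * 2 ≤ #(prefixed B) := (Nat.mul_le_mul_left _ (by omega)).trans h1
        have h6 := card_prefixed_mul_choose B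
        rw [← hN] at h6
        have h7 : N.choose #B ≤ N.choose 4 := by
          rw [← choose_symm (by omega : #B ≤ N)]
          have a2 : N.choose 2 ≤ N.choose 3 := choose_le_succ_of_lt_half_left (by omega)
          have a3 : N.choose 3 ≤ N.choose 4 := choose_le_succ_of_lt_half_left (by omega)
          have : N - #B = 2 ∨ N - #B = 3 ∨ N - #B = 4 := by omega
          rcases this with h | h | h <;> rw [h] <;> omega
        have h8 : 2 * N.choose 4 ≤ N.choose (N / 2) := by
          refine le_trans ?_ (choose_le_middle 5 N)
          have e : N.choose 5 * 5 = N.choose 4 * (N - 4) := choose_succ_right_eq N 4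
          have : N.choose 4 * 10 ≤ N.choose 4 * (N - 4) := Nat.mul_le_mul_left _ (by omega)
          omega
        calc 4 * N ! = 4 * (#(prefixed B) * N.choose #B) := by rw [h6]
          _ ≤ 4 * ((2 * q) * N.choose #B) := by gcongr; omega
          _ = 4 * q * (2 * N.choose #B) := by ring
          _ ≤ 4 * q * N.choose (N / 2) := by gcongr; omega
          _ ≤ 5 * q * N.choose (N / 2) := by gcongr; omega
          _ = _ := by ring
    · refine ⟨prefixed B, fun hB => ⟨subset_rfl, fun C hC hBC => absurd ⟨hB, C, hC, hBC⟩ hL, ?_⟩⟩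
      have h6 := factorial_le_card_prefixed_mul B
      rw [← hN] at h6
      calc 4 * N ! ≤ 4 * (#(prefixed B) * N.choose (N / 2)) := Nat.mul_le_mul_left _ h6
        _ ≤ 5 * (#(prefixed B) * N.choose (N / 2)) := by gcongr; omega
        _ = _ := by ring
  choose Q hQ using hi
  have hdisj : (G : Set (Finset X)).PairwiseDisjoint Q := by
    intro A hA D hD hne
    refine disjoint_left.2 fun f hfA hfD => ?_
    have hA' := (hQ A hA).1 hfA
    have hD' := (hQ D hD).1 hfD
    rcases ssubset_or_ssubset_of_mem_prefixed hA' hD' hne with h | h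
    · exact disjoint_left.1 ((hQ A hA).2.1 D hD h) hfA hD'
    · exact disjoint_left.1 ((hQ D hD).2.1 A hA h) hfD hA'
  have hsum : ∑ A ∈ G, #(Q A) ≤ N ! := by
    rw [← card_biUnion hdisj, hN, ← Fintype.card_numbering]
    exact card_le_univ _
  have hle : #G * (4 * N !) ≤ 5 * N.choose (N / 2) * N ! :=
    calc #G * (4 * N !) = ∑ _A ∈ G, 4 * N ! := by simp
      _ ≤ ∑ A ∈ G, 5 * N.choose (N / 2) * #(Q A) := sum_le_sum fun A hA => (hQ A hA).2.2
      _ = 5 * N.choose (N / 2) * ∑ A ∈ G, #(Q A) := by rw [mul_sum]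
      _ ≤ _ := Nat.mul_le_mul_left _ hsum
  refine Nat.le_of_mul_le_mul_right (c := N !) ?_ (factorial_pos N)
  linarith

open Finset Nat Numbering in
/-- A butterfly-free family containing neither the empty set nor the whole set has at most twice as
many members as the middle level. -/
lemma card_le_two_mul_of_butterflyFree {X : Type*} [Fintype X] [DecidableEq X]
    (G : Finset (Finset X)) (hempty : ∅ ∉ G) (huniv : univ ∉ G) (hG : ButterflyFree G) :
    #G ≤ 2 * (Fintype.card X).choose (Fintype.card X / 2) := by
  classical
  set M := G.filter fun B => (∃ A ∈ G, A ⊂ B) ∧ ∃ C ∈ G, B ⊂ C with hM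
  have hlo : ∀ B : Finset X, ∃ A, B ∈ M → A ∈ G ∧ A ⊂ B := by
    intro B
    by_cases h : B ∈ M
    · obtain ⟨A, hA⟩ := (mem_filter.1 h).2.1
      exact ⟨A, fun _ => hA⟩
    · exact ⟨∅, fun h' => absurd h' h⟩
  have hhi : ∀ B : Finset X, ∃ C, B ∈ M → C ∈ G ∧ B ⊂ C := by
    intro B
    by_cases h : B ∈ M
    · obtain ⟨C, hC⟩ := (mem_filter.1 h).2.2
      exact ⟨C, fun _ => hC⟩
    · exact ⟨∅, fun h' => absurd h' h⟩
  choose lo hlo using hlo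
  choose hi hhi using hhi
  have hMG : ∀ B ∈ M, B ∈ G := fun B hB => (mem_filter.1 hB).1
  have lo_uniq : ∀ B ∈ M, ∀ D ∈ G, D ⊂ B → D = lo B := by
    intro B hB D hD hDB
    by_contra hne
    obtain ⟨h1, h2⟩ := hlo B hB
    obtain ⟨h3, h4⟩ := hhi B hB
    exact hG ⟨D, lo B, B, hi B, hD, h1, hMG B hB, h3, hne, hDB.ne, (hDB.trans h4).ne, h2.ne,
      (h2.trans h4).ne, h4.ne, hDB.subset, (hDB.trans h4).subset, h2.subset, (h2.trans h4).subset⟩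
  have hi_uniq : ∀ B ∈ M, ∀ D ∈ G, B ⊂ D → D = hi B := by
    intro B hB D hD hBD
    by_contra hne
    obtain ⟨h1, h2⟩ := hlo B hB
    obtain ⟨h3, h4⟩ := hhi B hB
    exact hG ⟨lo B, B, D, hi B, h1, hMG B hB, hD, h3, h2.ne, (h2.trans hBD).ne, (h2.trans h4).ne,
      hBD.ne, h4.ne, hne, (h2.trans hBD).subset, (h2.trans h4).subset, hBD.subset, h4.subset⟩
  set T : Finset X → Finset (Numbering X) := fun B =>
    prefixed B ∩ (prefixed (lo B) ∩ prefixed (hi B)) with hT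
  set U : Finset X → Finset (Numbering X) := fun B =>
    prefixed B \ (prefixed (lo B) ∪ prefixed (hi B)) with hU
  have hTU : ∀ B ∈ M, #(T B) ≤ #(U B) := by
    intro B hB
    obtain ⟨h1, h2⟩ := hlo B hB
    obtain ⟨h3, h4⟩ := hhi B hB
    have k1 := card_prefixed_inter_lower h2 (fun h => hempty (h ▸ h1))
    have hCu : hi B ≠ univ := fun h => huniv (h ▸ h3)
    have k2 := card_prefixed_inter_upper h4 hCu
    have h5 := card_lt_card h4
    have h6 : #(hi B) < Fintype.card X := (card_lt_iff_ne_univ _).2 hCu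
    have k3 : #(prefixed B ∩ prefixed (hi B)) * 2 ≤ #(prefixed B) :=
      (Nat.mul_le_mul_left _ (by omega)).trans k2
    have k4 := card_sdiff_add_card_inter (prefixed B) (prefixed (lo B) ∪ prefixed (hi B))
    have k5 := card_union_add_card_inter (prefixed B ∩ prefixed (lo B))
      (prefixed B ∩ prefixed (hi B))
    rw [← inter_union_distrib_left, ← inter_inter_distrib_left] at k5
    rw [inter_comm] at k1
    simp only [hT, hU]
    omega
  have hpoint : ∀ f : Numbering X, #(G.filter (f ∈ prefixed ·)) + #(M.filter (f ∈ U ·)) ≤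
      2 + #(M.filter (f ∈ T ·)) := by
    intro f
    by_cases hf : ∃ B ∈ M, f ∈ prefixed B
    · obtain ⟨B, hB, hfB⟩ := hf
      obtain ⟨h1, h2⟩ := hlo B hB
      obtain ⟨h3, h4⟩ := hhi B hB
      have hG' : ∀ D ∈ G, f ∈ prefixed D → D = B ∨ D = lo B ∨ D = hi B := by
        intro D hD hfD
        by_cases hDB : D = B
        · exact Or.inl hDB
        · rcases ssubset_or_ssubset_of_mem_prefixed hfD hfB hDB with h | h
          · exact Or.inr (Or.inl (lo_uniq B hB D hD h))
          · exact Or.inr (Or.inr (hi_uniq B hB D hD h))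
      have hMB : ∀ D ∈ M, f ∈ prefixed D → D = B := by
        intro D hD hfD
        rcases hG' D (hMG D hD) hfD with h | h | h
        · exact h
        · obtain ⟨h5, h6⟩ := hlo D hD
          have h7 := lo_uniq B hB _ h5 (by rw [h] at h6 ⊢; exact h6.trans h2)
          rw [h7, ← h] at h6
          exact absurd h6 (ssubset_irrefl _)
        · obtain ⟨h5, h6⟩ := hhi D hD
          have h7 := hi_uniq B hB _ h5 (by rw [h] at h6 ⊢; exact h4.trans h6)
          rw [h7, ← h] at h6
          exact absurd h6 (ssubset_irrefl _)
      have hUle : M.filter (f ∈ U ·) ⊆ {B} := by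
        intro D hD
        rw [mem_filter] at hD
        exact mem_singleton.2 (hMB D hD.1 (mem_sdiff.1 hD.2).1)
      have hUcard : #(M.filter (f ∈ U ·)) ≤ 1 := (card_le_card hUle).trans (by simp)
      by_cases hl : f ∈ prefixed (lo B) <;> by_cases hh : f ∈ prefixed (hi B)
      · have e1 : G.filter (f ∈ prefixed ·) ⊆ {B, lo B, hi B} := by
          intro D hD
          rw [mem_filter] at hD
          simpa using hG' D hD.1 hD.2
        have e2 : M.filter (f ∈ U ·) = ∅ := by
          refine filter_eq_empty_iff.2 fun D hD hfD => ?_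
          have := hMB D hD (mem_sdiff.1 hfD).1
          subst this
          exact (mem_sdiff.1 hfD).2 (mem_union_left _ hl)
        have e3 : B ∈ M.filter (f ∈ T ·) := by simp [hT, hB, hfB, hl, hh, -mem_prefixed]
        have e4 : 0 < #(M.filter (f ∈ T ·)) := card_pos.2 ⟨B, e3⟩
        have e5 := (card_le_card e1).trans card_le_three
        rw [e2, card_empty]
        omega
      · have e1 : G.filter (f ∈ prefixed ·) ⊆ {B, lo B} := by
          intro D hD
          rw [mem_filter] at hD
          rcases hG' D hD.1 hD.2 with h | h | h
          · simp [h]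
          · simp [h]
          · exact absurd (h ▸ hD.2) hh
        have e2 : M.filter (f ∈ U ·) = ∅ := by
          refine filter_eq_empty_iff.2 fun D hD hfD => ?_
          have := hMB D hD (mem_sdiff.1 hfD).1
          subst this
          exact (mem_sdiff.1 hfD).2 (mem_union_left _ hl)
        have e5 := (card_le_card e1).trans card_le_two
        rw [e2, card_empty]
        omega
      · have e1 : G.filter (f ∈ prefixed ·) ⊆ {B, hi B} := by
          intro D hD
          rw [mem_filter] at hD
          rcases hG' D hD.1 hD.2 with h | h | h
          · simp [h]
          · exact absurd (h ▸ hD.2) hl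
          · simp [h]
        have e2 : M.filter (f ∈ U ·) = ∅ := by
          refine filter_eq_empty_iff.2 fun D hD hfD => ?_
          have := hMB D hD (mem_sdiff.1 hfD).1
          subst this
          exact (mem_sdiff.1 hfD).2 (mem_union_right _ hh)
        have e5 := (card_le_card e1).trans card_le_two
        rw [e2, card_empty]
        omega
      · have e1 : G.filter (f ∈ prefixed ·) ⊆ {B} := by
          intro D hD
          rw [mem_filter] at hD
          rcases hG' D hD.1 hD.2 with h | h | h
          · simp [h]
          · exact absurd (h ▸ hD.2) hl
          · exact absurd (h ▸ hD.2) hh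
        have e5 := (card_le_card e1).trans (card_singleton B).le
        omega
    · have e2 : M.filter (f ∈ U ·) = ∅ :=
        filter_eq_empty_iff.2 fun D hD hfD => hf ⟨D, hD, (mem_sdiff.1 hfD).1⟩
      have e1 : #(G.filter (f ∈ prefixed ·)) ≤ 2 := by
        by_contra hlt
        obtain ⟨A, B, C, hA, hB, hC, hAB, hAC, hBC⟩ := two_lt_card_iff.1 (not_le.1 hlt)
        rw [mem_filter] at hA hB hC
        have mid : ∀ {A B C : Finset X}, A ∈ G → B ∈ G → C ∈ G → f ∈ prefixed B →
            A ⊂ B → B ⊂ C → False := fun hA hB hC hfB h h' =>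
          hf ⟨_, mem_filter.2 ⟨hB, ⟨_, hA, h⟩, _, hC, h'⟩, hfB⟩
        rcases ssubset_or_ssubset_of_mem_prefixed hA.2 hB.2 hAB with h1 | h1 <;>
        rcases ssubset_or_ssubset_of_mem_prefixed hB.2 hC.2 hBC with h2 | h2 <;>
        rcases ssubset_or_ssubset_of_mem_prefixed hA.2 hC.2 hAC with h3 | h3
        · exact mid hA.1 hB.1 hC.1 hB.2 h1 h2
        · exact mid hA.1 hB.1 hC.1 hB.2 h1 h2
        · exact mid hA.1 hC.1 hB.1 hC.2 h3 h2
        · exact mid hC.1 hA.1 hB.1 hA.2 h3 h1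
        · exact mid hB.1 hA.1 hC.1 hA.2 h1 h3
        · exact mid hB.1 hC.1 hA.1 hC.2 h2 h3
        · exact mid hC.1 hB.1 hA.1 hB.2 h2 h1
        · exact mid hC.1 hB.1 hA.1 hB.2 h2 h1
      rw [e2, card_empty]
      omega
  have swap : ∀ (H : Finset (Finset X)) (P : Finset X → Finset (Numbering X)),
      ∑ f : Numbering X, #(H.filter (f ∈ P ·)) = ∑ A ∈ H, #(P A) := by
    intro H P
    simp_rw [card_filter]
    rw [sum_comm]
    refine sum_congr rfl fun A _ => ?_
    rw [← card_filter]
    congr 1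
    ext f
    simp
  have hsum := sum_le_sum fun f (_ : f ∈ (univ : Finset (Numbering X))) => hpoint f
  rw [sum_add_distrib, sum_add_distrib, swap, swap, swap, sum_const, Finset.card_univ,
    Fintype.card_numbering] at hsum
  have hTU' := sum_le_sum hTU
  have hL : ∑ A ∈ G, #(prefixed A) ≤ 2 * (Fintype.card X)! := by
    simp only [smul_eq_mul] at hsum
    omega
  have hle : #G * (Fintype.card X)! ≤
      2 * (Fintype.card X)! * (Fintype.card X).choose (Fintype.card X / 2) :=
    calc #G * (Fintype.card X)! = ∑ _A ∈ G, (Fintype.card X)! := by simp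
      _ ≤ ∑ A ∈ G, #(prefixed A) * (Fintype.card X).choose (Fintype.card X / 2) :=
        sum_le_sum fun A _ => factorial_le_card_prefixed_mul A
      _ = (∑ A ∈ G, #(prefixed A)) * (Fintype.card X).choose (Fintype.card X / 2) := by
        rw [sum_mul]
      _ ≤ _ := Nat.mul_le_mul_right _ hL
  refine Nat.le_of_mul_le_mul_right (c := (Fintype.card X)!) ?_ (factorial_pos _)
  linarith

lemma thirteen_mul_choose_lt_four_mul_SigmaI {n : ℕ} (hn : 18 ≤ n) :
    13 * (n - 1).choose ((n - 1) / 2) + 16 < 4 * SigmaI n 2 := by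
  have hbig : 136 ≤ (n - 1).choose ((n - 1) / 2) := by
    refine le_trans ?_ (Nat.choose_le_middle 2 (n - 1))
    exact le_trans (by decide) (Nat.choose_le_choose 2 (by omega : 17 ≤ n - 1))
  rcases Nat.even_or_odd' n with ⟨m, rfl | rfl⟩
  · have hm : 9 ≤ m := by omega
    obtain ⟨m, rfl⟩ := Nat.exists_eq_add_of_le' (by omega : 1 ≤ m)
    have e : SigmaI (2 * (m + 1)) 2 = (2 * m + 1).choose m + (2 * m + 2).choose (m + 2) +
        (2 * m + 1).choose (m + 3) := by
      simp [SigmaI, mul_add]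
    rw [show (2 * (m + 1) - 1) / 2 = m by omega, show 2 * (m + 1) - 1 = 2 * m + 1 by omega]
      at hbig ⊢
    rw [e]
    clear e
    have h0 := Nat.choose_symm_half m
    have h1 : (2 * m + 1).choose (m + 2) * (m + 2) =
        (2 * m + 1).choose (m + 1) * (2 * m + 1 - (m + 1)) := Nat.choose_succ_right_eq _ _
    have h2 : (2 * m + 1).choose (m + 3) * (m + 3) =
        (2 * m + 1).choose (m + 2) * (2 * m + 1 - (m + 2)) := Nat.choose_succ_right_eq _ _
    have h3 : (2 * m + 2).choose (m + 2) =
        (2 * m + 1).choose (m + 1) + (2 * m + 1).choose (m + 2) :=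
      Nat.choose_succ_succ' (2 * m + 1) (m + 1)
    rw [show 2 * m + 1 - (m + 1) = m by omega] at h1
    rw [show 2 * m + 1 - (m + 2) = m - 1 by omega] at h2
    obtain ⟨k, rfl⟩ := Nat.exists_eq_add_of_le' (by omega : 8 ≤ m)
    simp only [show k + 8 - 1 = k + 7 by omega] at h2
    rw [h3, h0]
    rw [h0] at h1
    generalize (2 * (k + 8) + 1).choose (k + 8) = x at *
    generalize (2 * (k + 8) + 1).choose (k + 8 + 2) = y at *
    generalize (2 * (k + 8) + 1).choose (k + 8 + 3) = z at *
    have hy : 4 * x ≤ 5 * y := by nlinarith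
    have hz : 7 * y ≤ 11 * z := by nlinarith
    omega
  · have hm : 9 ≤ m := by omega
    have e : SigmaI (2 * m + 1) 2 = (2 * m + 1).choose (m + 1) + (2 * m + 1).choose (m + 2) := by
      have h1 : (2 * m + 1 + 1) / 2 = m + 1 := by omega
      have h2 : (2 * m + 1) % 2 = 1 := by omega
      rw [SigmaI, if_pos h2, h1, show m + 1 + 2 - 1 = m + 1 + 1 by omega,
        Finset.sum_Icc_succ_top (by omega), Finset.Icc_self, Finset.sum_singleton]
    rw [e]
    simp only [show 2 * m + 1 - 1 = 2 * m by omega, show 2 * m / 2 = m by omega] at *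
    have h1 := Nat.choose_succ_right_eq (2 * m) m
    have h2 := Nat.choose_succ_right_eq (2 * m) (m + 1)
    have h3 := Nat.choose_succ_succ' (2 * m) m
    have h4 := Nat.choose_succ_succ' (2 * m) (m + 1)
    rw [show 2 * m - m = m by omega] at h1
    rw [show 2 * m - (m + 1) = m - 1 by omega] at h2
    obtain ⟨k, rfl⟩ := Nat.exists_eq_add_of_le' hm
    simp only [show k + 9 - 1 = k + 8 by omega] at h2
    simp only [show k + 9 + 1 + 1 = k + 9 + 2 by omega] at *
    rw [h3, h4]
    generalize (2 * (k + 9)).choose (k + 9) = x at *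
    generalize (2 * (k + 9)).choose (k + 9 + 1) = y at *
    generalize (2 * (k + 9)).choose (k + 9 + 2) = z at *
    have hy : 9 * x ≤ 10 * y := by nlinarith
    have hz : 8 * y ≤ 11 * z := by nlinarith
    omega

open Finset in
/-- Deleting the point `x` maps a family whose members agree on `x` to a family of the same shape,
with the empty and the whole set discarded. -/
lemma exists_restriction {n : ℕ} (x : Fin n) (F : Finset (Finset (Fin n)))
    (hF : ∀ A ∈ F, ∀ B ∈ F, (x ∈ A ↔ x ∈ B)) :
    ∃ G : Finset (Finset {y : Fin n // y ≠ x}), ∅ ∉ G ∧ univ ∉ G ∧ #F ≤ #G + 2 ∧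
      ∃ φ : Finset {y : Fin n // y ≠ x} → Finset (Fin n),
        (∀ A ∈ G, φ A ∈ F ∧ ∃ y ∈ φ A, y ≠ x) ∧
        ∀ A ∈ G, ∀ B ∈ G, (A ⊆ B ↔ φ A ⊆ φ B) := by
  classical
  set r : Finset (Fin n) → Finset {y : Fin n // y ≠ x} := fun A => A.subtype (· ≠ x) with hr
  have hsub : ∀ A ∈ F, ∀ B ∈ F, (r A ⊆ r B ↔ A ⊆ B) := by
    intro A hA B hB
    constructor
    · intro h y hy
      by_cases hyx : y = x
      · subst hyx
        exact (hF A hA B hB).1 hy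
      · exact mem_subtype.1 (h (mem_subtype.2 hy : (⟨y, hyx⟩ : {y : Fin n // y ≠ x}) ∈ r A))
    · intro h y hy
      exact mem_subtype.2 (h (mem_subtype.1 hy))
  have hinj : Set.InjOn r F := fun A hA B hB h =>
    Subset.antisymm ((hsub A hA B hB).1 h.subset) ((hsub B hB A hA).1 h.symm.subset)
  have hφ : ∀ A, ∃ A', A ∈ F.image r → A' ∈ F ∧ r A' = A := by
    intro A
    by_cases h : A ∈ F.image r
    · obtain ⟨A', h'⟩ := mem_image.1 h
      exact ⟨A', fun _ => h'⟩
    · exact ⟨∅, fun h' => absurd h' h⟩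
  choose φ hφ using hφ
  refine ⟨F.image r \ {∅, univ}, by simp, by simp, ?_, φ, ?_, ?_⟩
  · have h1 := le_card_sdiff {∅, univ} (F.image r)
    rw [card_image_of_injOn hinj] at h1
    have h2 : #({∅, univ} : Finset (Finset {y : Fin n // y ≠ x})) ≤ 2 := card_le_two
    omega
  · intro A hA
    obtain ⟨hA, hA'⟩ := mem_sdiff.1 hA
    obtain ⟨h1, h2⟩ := hφ A hA
    refine ⟨h1, ?_⟩
    obtain ⟨y, hy⟩ := nonempty_iff_ne_empty.2 fun h : A = ∅ => hA' (by simp [h])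
    rw [← h2] at hy
    exact ⟨y, mem_subtype.1 hy, y.2⟩
  · intro A hA B hB
    obtain ⟨h1, h2⟩ := hφ A (mem_sdiff.1 hA).1
    obtain ⟨h3, h4⟩ := hφ B (mem_sdiff.1 hB).1
    rw [← hsub _ h1 _ h3, h2, h4]

open Finset in
lemma card_lt_SigmaI_of_singleton_mem {n : ℕ} (hn : 18 ≤ n) {F : Finset (Finset (Fin n))}
    (hB : ButterflyFree F) {x : Fin n} (hx : {x} ∈ F) : #F < SigmaI n 2 := by
  have hcard : Fintype.card {y : Fin n // y ≠ x} = n - 1 := by simp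
  obtain ⟨G₀, he₀, hu₀, hc₀, φ₀, hm₀, hs₀⟩ := exists_restriction x (F.filter (x ∉ ·))
    (fun A hA B hB => by rw [mem_filter] at hA hB; tauto)
  obtain ⟨G₁, he₁, hu₁, hc₁, φ₁, hm₁, hs₁⟩ := exists_restriction x (F.filter (x ∈ ·))
    (fun A hA B hB => by rw [mem_filter] at hA hB; tauto)
  have hne : ∀ A ∈ G₀, ∀ B ∈ G₀, A ≠ B → φ₀ A ≠ φ₀ B := fun A hA B hB hne h =>
    hne (Subset.antisymm ((hs₀ A hA B hB).2 h.subset) ((hs₀ B hB A hA).2 h.symm.subset))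
  have hne₁ : ∀ A ∈ G₁, ∀ B ∈ G₁, A ≠ B → φ₁ A ≠ φ₁ B := fun A hA B hB hne h =>
    hne (Subset.antisymm ((hs₁ A hA B hB).2 h.subset) ((hs₁ B hB A hA).2 h.symm.subset))
  have hF₀ : ∀ A ∈ G₀, φ₀ A ∈ F := fun A hA => (mem_filter.1 (hm₀ A hA).1).1
  have hF₁ : ∀ A ∈ G₁, φ₁ A ∈ F := fun A hA => (mem_filter.1 (hm₁ A hA).1).1
  have hbf : ButterflyFree G₀ := by
    rintro ⟨A, B, C, D, hA, hB', hC, hD, h1, h2, h3, h4, h5, h6, h7, h8, h9, h10⟩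
    exact hB ⟨φ₀ A, φ₀ B, φ₀ C, φ₀ D, hF₀ A hA, hF₀ B hB', hF₀ C hC, hF₀ D hD,
      hne _ hA _ hB' h1, hne _ hA _ hC h2, hne _ hA _ hD h3, hne _ hB' _ hC h4,
      hne _ hB' _ hD h5, hne _ hC _ hD h6, (hs₀ _ hA _ hC).1 h7, (hs₀ _ hA _ hD).1 h8,
      (hs₀ _ hB' _ hC).1 h9, (hs₀ _ hB' _ hD).1 h10⟩
  have hsing : ∀ A ∈ G₁, {x} ≠ φ₁ A := by
    intro A hA h
    obtain ⟨y, hy, hyx⟩ := (hm₁ A hA).2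
    rw [← h] at hy
    exact hyx (mem_singleton.1 hy)
  have hmem : ∀ A ∈ G₁, {x} ⊆ φ₁ A := fun A hA =>
    singleton_subset_iff.2 (mem_filter.1 (hm₁ A hA).1).2
  have hfork : ∀ B ∈ G₁, ∀ C ∈ G₁, ∀ D ∈ G₁, B ⊂ C → B ⊂ D → C = D := by
    intro B hB' C hC D hD hBC hBD
    by_contra hCD
    exact hB ⟨{x}, φ₁ B, φ₁ C, φ₁ D, hx, hF₁ B hB', hF₁ C hC, hF₁ D hD,
      hsing B hB', hsing C hC, hsing D hD, hne₁ _ hB' _ hC hBC.ne, hne₁ _ hB' _ hD hBD.ne,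
      hne₁ _ hC _ hD hCD, hmem C hC, hmem D hD, (hs₁ _ hB' _ hC).1 hBC.subset,
      (hs₁ _ hB' _ hD).1 hBD.subset⟩
  have b₀ := card_le_two_mul_of_butterflyFree G₀ he₀ hu₀ hbf
  have b₁ := four_mul_card_le_of_forkFree (by rw [hcard]; omega) G₁ hu₁ hfork
  rw [hcard] at b₀ b₁
  have hsplit := card_filter_add_card_filter_not (s := F) (x ∈ ·)
  have := thirteen_mul_choose_lt_four_mul_SigmaI hn
  omega

open Finset in
lemma ButterflyFree.image_compl {X : Type*} [Fintype X] [DecidableEq X] {F : Finset (Finset X)}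
    (hF : ButterflyFree F) : ButterflyFree (F.image compl) := by
  rintro ⟨A, B, C, D, hA, hB, hC, hD, h1, h2, h3, h4, h5, h6, h7, h8, h9, h10⟩
  simp only [mem_image] at hA hB hC hD
  obtain ⟨A, hA, rfl⟩ := hA
  obtain ⟨B, hB, rfl⟩ := hB
  obtain ⟨C, hC, rfl⟩ := hC
  obtain ⟨D, hD, rfl⟩ := hD
  simp only [compl_subset_compl, ne_eq, compl_inj_iff] at *
  exact hF ⟨C, D, A, B, hC, hD, hA, hB, h6, Ne.symm h2, Ne.symm h4, Ne.symm h3, Ne.symm h5, h1,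
    h7, h9, h8, h10⟩

theorem butterflyFree_small_or_large_set (n : ℕ) (hn : 18 ≤ n)
    (F : Finset (Finset (Fin n))) (hB : ButterflyFree F)
    (hset : ∃ A ∈ F, A.card = 1 ∨ A.card = n - 1) :
    F.card < SigmaI n 2 := by
  obtain ⟨A, hA, h | h⟩ := hset
  · obtain ⟨x, rfl⟩ := Finset.card_eq_one.1 h
    exact card_lt_SigmaI_of_singleton_mem hn hB hA
  · have h' : Aᶜ.card = 1 := by
      rw [Finset.card_compl, h, Fintype.card_fin]
      omega
    obtain ⟨x, hx⟩ := Finset.card_eq_one.1 h'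
    rw [← Finset.card_image_of_injective F compl_injective]
    refine card_lt_SigmaI_of_singleton_mem hn hB.image_compl (x := x) ?_
    rw [← hx]
    exact Finset.mem_image_of_mem _ hA
end
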